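/- Let G be a connected affine Nash group. Then the unique connected normal almost linear Nash subgroup H of G such that some quotient of G by H is an abelian Nash manifold coincides with the largest connected almost linear Nash subgroup of G; in particular, some quotient of G by the largest connected almost linear Nash subgroup is an abelian Nash manifold. -/

import Mathlib

open Set

/-- A basic semialgebraic subset of `ℝⁿ`, given by one polynomial equation
`p = 0` and finitely many polynomial inequalities `g > 0`. -/
def BasicSemialgebraic {n : ℕ} (p : MvPolynomial (Fin n) ℝ)
    (gs : List (MvPolynomial (Fin n) ℝ)) : Set (Fin n → ℝ) :=
  {x | MvPolynomial.eval x p = 0 ∧ ∀ g ∈ gs, 0 < MvPolynomial.eval x g}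

/-- A subset of `ℝⁿ` is semialgebraic if it is a finite union of finite
intersections of basic semialgebraic sets. -/
def IsSemialgebraic {n : ℕ} (S : Set (Fin n → ℝ)) : Prop :=
  ∃ L : List (List (MvPolynomial (Fin n) ℝ × List (MvPolynomial (Fin n) ℝ))),
    S = ⋃ c ∈ L, ⋂ b ∈ c, BasicSemialgebraic b.1 b.2

/-- `S` is a `d`-dimensional real analytic submanifold of `ℝⁿ`: around each of
its points there is an analytic chart of `ℝⁿ` flattening `S` onto the first `d`
coordinates. -/
def IsAnalyticSubmanifold {n : ℕ} (d : ℕ) (S : Set (Fin n → ℝ)) : Prop :=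
  ∀ x ∈ S, ∃ (U V : Set (Fin n → ℝ)) (φ ψ : (Fin n → ℝ) → (Fin n → ℝ)),
    IsOpen U ∧ IsOpen V ∧ x ∈ U ∧
    AnalyticOnNhd ℝ φ U ∧ AnalyticOnNhd ℝ ψ V ∧
    (∀ y ∈ U, φ y ∈ V) ∧ (∀ y ∈ V, ψ y ∈ U) ∧
    (∀ y ∈ U, ψ (φ y) = y) ∧ (∀ y ∈ V, φ (ψ y) = y) ∧
    φ '' (U ∩ S) = V ∩ {y | ∀ i : Fin n, d ≤ (i : ℕ) → y i = 0}

/-- `f` is real analytic on `S`: near each point of `S` it is the restriction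
of a real analytic map defined on an open set. -/
def LocAnalyticOn {n m : ℕ} (S : Set (Fin n → ℝ)) (f : (Fin n → ℝ) → (Fin m → ℝ)) : Prop :=
  ∀ x ∈ S, ∃ U : Set (Fin n → ℝ), IsOpen U ∧ x ∈ U ∧
    ∃ g : (Fin n → ℝ) → (Fin m → ℝ), AnalyticOnNhd ℝ g U ∧ ∀ y ∈ U ∩ S, g y = f y

/-- The graph of `f` restricted to `S`, as a subset of `ℝ^(n+m)`. -/
def NashGraph {n m : ℕ} (S : Set (Fin n → ℝ)) (f : (Fin n → ℝ) → (Fin m → ℝ)) :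
    Set (Fin (n + m) → ℝ) :=
  {z | ∃ x ∈ S, z = Fin.append x (f x)}

/-- A Nash mapping on `S`: real analytic with semialgebraic graph. -/
def IsNashMapOn {n m : ℕ} (S : Set (Fin n → ℝ)) (f : (Fin n → ℝ) → (Fin m → ℝ)) : Prop :=
  LocAnalyticOn S f ∧ IsSemialgebraic (NashGraph S f)

/-- First `n` coordinates of a point of `ℝ^(n+m)`. -/
def frontHalf {n m : ℕ} (z : Fin (n + m) → ℝ) : Fin n → ℝ := fun i => z (Fin.castAdd m i)

/-- Last `m` coordinates of a point of `ℝ^(n+m)`. -/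
def backHalf {n m : ℕ} (z : Fin (n + m) → ℝ) : Fin m → ℝ := fun i => z (Fin.natAdd n i)

/-- An affine Nash group: a semialgebraic analytic submanifold of some `ℝⁿ`
together with a group structure whose multiplication and inversion are Nash
mappings. -/
structure NashGroup where
  n : ℕ
  dim : ℕ
  carrier : Set (Fin n → ℝ)
  semialg : IsSemialgebraic carrier
  submanifold : IsAnalyticSubmanifold dim carrier
  one : Fin n → ℝ
  mul : (Fin n → ℝ) → (Fin n → ℝ) → (Fin n → ℝ)
  inv : (Fin n → ℝ) → (Fin n → ℝ)
  one_mem : one ∈ carrier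
  mul_mem : ∀ x ∈ carrier, ∀ y ∈ carrier, mul x y ∈ carrier
  inv_mem : ∀ x ∈ carrier, inv x ∈ carrier
  mul_assoc : ∀ x ∈ carrier, ∀ y ∈ carrier, ∀ z ∈ carrier,
    mul (mul x y) z = mul x (mul y z)
  one_mul : ∀ x ∈ carrier, mul one x = x
  mul_one : ∀ x ∈ carrier, mul x one = x
  inv_mul_cancel : ∀ x ∈ carrier, mul (inv x) x = one
  mul_nash : IsNashMapOn {z : Fin (n + n) → ℝ | frontHalf z ∈ carrier ∧ backHalf z ∈ carrier}
      (fun z => mul (frontHalf z) (backHalf z))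
  inv_nash : IsNashMapOn carrier inv

/-- A Nash subgroup of an affine Nash group: a subgroup which is a
semialgebraic subset. -/
structure IsNashSubgroup (G : NashGroup) (H : Set (Fin G.n → ℝ)) : Prop where
  subset : H ⊆ G.carrier
  one_mem : G.one ∈ H
  mul_mem : ∀ x ∈ H, ∀ y ∈ H, G.mul x y ∈ H
  inv_mem : ∀ x ∈ H, G.inv x ∈ H
  semialg : IsSemialgebraic H

/-- `N` is a normal subset of the subgroup `K` of `G`. -/
def IsNormalIn (G : NashGroup) (K N : Set (Fin G.n → ℝ)) : Prop :=
  ∀ g ∈ K, ∀ x ∈ N, G.mul (G.mul g x) (G.inv g) ∈ N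

/-- A Nash homomorphism defined on the subgroup `H` of `G`, with values in the
affine Nash group `Q`. -/
structure IsNashHomOn (G : NashGroup) (H : Set (Fin G.n → ℝ)) (Q : NashGroup)
    (f : (Fin G.n → ℝ) → (Fin Q.n → ℝ)) : Prop where
  mapsTo : ∀ x ∈ H, f x ∈ Q.carrier
  map_mul : ∀ x ∈ H, ∀ y ∈ H, f (G.mul x y) = Q.mul (f x) (f y)
  nash : IsNashMapOn H f

/-- Flattening of a square matrix to a point of `ℝ^(m*m)`. -/
def matFlatten {m : ℕ} (A : Matrix (Fin m) (Fin m) ℝ) : Fin (m * m) → ℝ :=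
  fun k => A (finProdFinEquiv.symm k).1 (finProdFinEquiv.symm k).2

/-- The subgroup `H` of `G` is almost linear: it admits a Nash homomorphism
with finite kernel into `GL(m, ℝ)` for some `m`. -/
def AlmostLinearOn (G : NashGroup) (H : Set (Fin G.n → ℝ)) : Prop :=
  ∃ (m : ℕ) (f : (Fin G.n → ℝ) → Matrix (Fin m) (Fin m) ℝ),
    IsNashMapOn H (fun x => matFlatten (f x)) ∧
    (∀ x ∈ H, IsUnit (f x)) ∧
    (∀ x ∈ H, ∀ y ∈ H, f (G.mul x y) = f x * f y) ∧
    Set.Finite {x ∈ H | f x = 1}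

/-- An affine Nash group is almost linear if it admits a Nash homomorphism
with finite kernel into some `GL(m, ℝ)`. -/
def NashGroup.AlmostLinear (G : NashGroup) : Prop := AlmostLinearOn G G.carrier

/-- `Q` is a quotient of the subgroup `H` of `G` by a normal Nash subgroup:
there are a normal Nash subgroup `N` of `H` and a surjective Nash homomorphism
`H → Q` with kernel `N`. -/
def IsQuotientOf (G : NashGroup) (H : Set (Fin G.n → ℝ)) (Q : NashGroup) : Prop :=
  ∃ (N : Set (Fin G.n → ℝ)) (π : (Fin G.n → ℝ) → (Fin Q.n → ℝ)),
    IsNashSubgroup G N ∧ N ⊆ H ∧ IsNormalIn G H N ∧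
    IsNashHomOn G H Q π ∧ π '' H = Q.carrier ∧ {x ∈ H | π x = Q.one} = N

/-- The subgroup `H` of `G` is anti-linear: it has no quotient which is an
almost linear affine Nash group of positive dimension. -/
def AntiLinearOn (G : NashGroup) (H : Set (Fin G.n → ℝ)) : Prop :=
  ∀ Q : NashGroup, IsQuotientOf G H Q → Q.AlmostLinear → Q.dim = 0

/-- The subgroup `H` of `G` is toroidal: connected and anti-linear. -/
def ToroidalOn (G : NashGroup) (H : Set (Fin G.n → ℝ)) : Prop :=
  IsConnected H ∧ AntiLinearOn G H

/-- A toroidal affine Nash group: connected and anti-linear. -/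
def NashGroup.Toroidal (G : NashGroup) : Prop := ToroidalOn G G.carrier

/-- An affine Nash group is complete if it has no nontrivial connected almost
linear Nash subgroup. -/
def NashGroup.Complete (G : NashGroup) : Prop :=
  ∀ H, IsNashSubgroup G H → IsConnected H → AlmostLinearOn G H → H = {G.one}

/-- An abelian Nash manifold: a connected complete affine Nash group. -/
def AbelianNashManifold (G : NashGroup) : Prop := IsConnected G.carrier ∧ G.Complete

/-- Some quotient of `G` by `N` is an almost linear affine Nash group. -/
def HasAlmostLinearQuotientBy (G : NashGroup) (N : Set (Fin G.n → ℝ)) : Prop :=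
  ∃ (Q : NashGroup) (π : (Fin G.n → ℝ) → (Fin Q.n → ℝ)),
    IsNashHomOn G G.carrier Q π ∧ π '' G.carrier = Q.carrier ∧
    {x ∈ G.carrier | π x = Q.one} = N ∧ Q.AlmostLinear

/-- `y` and `y'` have the same position relative to the finite family `R` of paired points. -/
def SamePos (R : Set (ℝ × ℝ)) (y y' : ℝ) : Prop :=
  ∀ z ∈ R, (z.1 < y ↔ z.2 < y') ∧ (y < z.1 ↔ y' < z.2)

lemma SamePos.swap {R : Set (ℝ × ℝ)} {y y' : ℝ} (h : SamePos R y y') :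
    SamePos (Prod.swap '' R) y' y := by
  rintro _ ⟨z, hz, rfl⟩
  exact ⟨(h z hz).1.symm, (h z hz).2.symm⟩

lemma SamePos.of_swap {R : Set (ℝ × ℝ)} {y y' : ℝ} (h : SamePos (Prod.swap '' R) y y') :
    SamePos R y' y := by
  intro z hz
  have := h z.swap ⟨z, hz, rfl⟩
  exact ⟨this.1.symm, this.2.symm⟩

lemma SamePos.eq_iff {R : Set (ℝ × ℝ)} {y y' : ℝ} (h : SamePos R y y') {z : ℝ × ℝ} (hz : z ∈ R) :
    z.1 = y ↔ z.2 = y' := by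
  have := h z hz
  constructor <;> intro h' <;> apply le_antisymm <;> by_contra! hc <;> grind

lemma SamePos.exchange {R : Set (ℝ × ℝ)} {a a' b b' : ℝ} (h : SamePos R a a')
    (h₁ : SamePos R a b') (h₂ : SamePos R b a') : SamePos R b b' := fun z hz =>
  ⟨(h₂ z hz).1.trans ((h z hz).1.symm.trans (h₁ z hz).1),
    (h₂ z hz).2.trans ((h z hz).2.symm.trans (h₁ z hz).2)⟩

lemma exists_samePos {R : Set (ℝ × ℝ)} (hfin : R.Finite)
    (hR : ∀ z ∈ R, SamePos R z.1 z.2) (y : ℝ) : ∃ y', SamePos R y y' := by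
  classical
  by_cases hy : ∃ z ∈ R, z.1 = y
  · obtain ⟨z, hz, rfl⟩ := hy
    exact ⟨z.2, hR z hz⟩
  push Not at hy
  have h1 : {z ∈ R | z.1 < y}.Finite := hfin.subset (sep_subset _ _)
  have h2 : {z ∈ R | y < z.1}.Finite := hfin.subset (sep_subset _ _)
  obtain ⟨m, hm1, hm2⟩ := Order.exists_between_finsets
    (h1.toFinset.image Prod.snd) (h2.toFinset.image Prod.snd) (by
      intro a ha b hb
      simp only [Finset.mem_image, Finite.mem_toFinset, mem_sep_iff] at ha hb
      obtain ⟨z, ⟨hz, hzy⟩, rfl⟩ := ha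
      obtain ⟨w, ⟨hw, hwy⟩, rfl⟩ := hb
      exact ((hR w hw) z hz).1.1 (hzy.trans hwy))
  refine ⟨m, fun z hz => ?_⟩
  rcases lt_or_gt_of_ne (hy z hz) with h | h
  · have : z.2 < m := hm1 _ (by simp only [Finset.mem_image, Finite.mem_toFinset]; exact ⟨z, ⟨hz, h⟩, rfl⟩)
    exact ⟨iff_of_true h this, iff_of_false h.not_gt this.not_gt⟩
  · have : m < z.2 := hm2 _ (by simp only [Finset.mem_image, Finite.mem_toFinset]; exact ⟨z, ⟨hz, h⟩, rfl⟩)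
    exact ⟨iff_of_false h.not_gt this.not_gt, iff_of_true h this⟩

open Polynomial in
lemma exists_eval_neg_of_derivative_pos_left {g : ℝ[X]} {c : ℝ}
    (hg : ∀ y ≤ c, 0 < g.derivative.eval y) : ∃ y ≤ c, g.eval y < 0 := by
  by_contra! hc
  have hmono : StrictMonoOn (fun x => g.eval x) (Iic c) := by
    apply strictMonoOn_of_deriv_pos (convex_Iic c) g.continuous.continuousOn
    intro x hx
    rw [interior_Iic] at hx
    simpa using hg x hx.le
  have hdeg : 0 < g.degree := by
    by_contra! h
    rw [eq_C_of_degree_le_zero h] at hg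
    simpa using hg c le_rfl
  have hdeg' : 0 < (g.comp (-X)).degree := by
    rw [← natDegree_pos_iff_degree_pos] at hdeg ⊢
    simpa [natDegree_comp] using hdeg
  have ht := (g.comp (-X)).abs_tendsto_atTop hdeg'
  obtain ⟨x, hx1, hx2⟩ := ((ht.eventually_gt_atTop (g.eval c)).and
    (Filter.eventually_ge_atTop (-c))).exists
  have hxc : -x ≤ c := by linarith
  simp only [eval_comp, eval_neg, eval_X] at hx1
  rw [abs_of_nonneg (hc _ hxc)] at hx1
  exact absurd (hmono.monotoneOn hxc (mem_Iic.2 le_rfl) hxc) (not_le.2 hx1)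

open Polynomial in
/-- On matching gaps where both polynomials increase, negative values transfer. -/
lemma transfer_neg {R : Set (ℝ × ℝ)} (hfin : R.Finite) {f g : ℝ[X]} {y₀ y₀' : ℝ}
    (h₀ : SamePos R y₀ y₀') (hgap : ∀ z ∈ R, z.1 ≠ y₀)
    (hf : ∀ y, SamePos R y y₀' → 0 < f.derivative.eval y)
    (hg : ∀ y', SamePos R y₀ y' → 0 < g.derivative.eval y')
    (hR : ∀ z ∈ R, SamePos R z.1 z.2)
    (hz : ∀ z ∈ R, SignType.sign (f.eval z.1) = SignType.sign (g.eval z.2))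
    (hneg : ∃ y, SamePos R y y₀' ∧ f.eval y < 0) :
    ∃ y', SamePos R y₀ y' ∧ g.eval y' < 0 := by
  obtain ⟨y, hy, hfy⟩ := hneg
  by_cases hl : ∃ z ∈ R, z.1 < y₀
  · obtain ⟨z, ⟨hzR, hzy⟩, hmax⟩ := (hfin.subset (sep_subset R (fun z => z.1 < y₀))).exists_maximalFor
      Prod.fst _ hl
    have hmax' : ∀ w ∈ R, w.1 < y₀ → w.1 ≤ z.1 := by
      intro w hw hwy
      by_contra! hc
      exact absurd (hmax ⟨hw, hwy⟩ hc.le) (not_le.2 hc)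
    have hzy' : z.2 < y₀' := (h₀ z hzR).1.1 hzy
    have key : ∀ t, z.1 < t → t ≤ y → SamePos R t y₀' := by
      intro t h1 h2 w hw
      have a := h₀ w hw
      have b := hy w hw
      have c := hmax' w hw
      have d := hgap w hw
      constructor
      · constructor
        · intro h; exact b.1.1 (h.trans_le h2)
        · intro h; exact (c (a.1.2 h)).trans_lt h1
      · constructor
        · intro h
          rw [← a.2]
          by_contra! hcc
          exact absurd (c (lt_of_le_of_ne hcc d)) (not_le.2 (h1.trans h))
        · intro h; exact h2.trans_lt (b.2.2 h)
    have hzy1 : z.1 < y := (hy z hzR).1.2 hzy'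
    have hmono : StrictMonoOn (fun x => f.eval x) (Icc z.1 y) := by
      apply strictMonoOn_of_deriv_pos (convex_Icc _ _) f.continuous.continuousOn
      intro x hx
      rw [interior_Icc] at hx
      simpa using hf x (key x hx.1 hx.2.le)
    have hfz : f.eval z.1 < 0 :=
      (hmono (left_mem_Icc.2 hzy1.le) (right_mem_Icc.2 hzy1.le) hzy1).trans hfy
    have hgz : g.eval z.2 < 0 := by
      rw [← sign_eq_neg_one_iff, ← hz z hzR, sign_eq_neg_one_iff]; exact hfz
    have hev : ∀ᶠ t in nhdsWithin z.2 (Ioi z.2), g.eval t < 0 :=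
      (g.continuous.continuousAt.eventually_lt continuousAt_const hgz).filter_mono nhdsWithin_le_nhds
    obtain ⟨t, ht, ht1, ht2⟩ := (hev.and (Ioo_mem_nhdsGT hzy')).exists
    refine ⟨t, fun w hw => ?_, ht⟩
    have a := h₀ w hw
    have b := hR w hw z hzR
    have b' := hR z hzR w hw
    have c := hmax' w hw
    have d := hgap w hw
    constructor
    · constructor
      · intro h
        rcases (c h).lt_or_eq with h' | h'
        · exact (b'.1.1 h').trans ht1
        · exact (((hR z hzR).eq_iff hw).1 h').trans_lt ht1
      · intro h; exact a.1.2 (h.trans ht2)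
    · constructor
      · intro h; exact ht2.trans (a.2.1 h)
      · intro h
        by_contra! hcc
        rcases (c (lt_of_le_of_ne hcc d)).lt_or_eq with h' | h'
        · exact absurd ((b'.1.1 h').trans ht1) (not_lt.2 h.le)
        · exact absurd ((((hR z hzR).eq_iff hw).1 h').trans_lt ht1) (not_lt.2 h.le)
  · push Not at hl
    have key : ∀ t ≤ y₀', SamePos R y₀ t := by
      intro t ht w hw
      have a := h₀ w hw
      have b := lt_of_le_of_ne (hl w hw) (hgap w hw).symm
      have c := a.2.1 b
      exact ⟨iff_of_false b.not_gt (ht.trans_lt c).not_gt, iff_of_true b (ht.trans_lt c)⟩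
    obtain ⟨t, ht, h⟩ := exists_eval_neg_of_derivative_pos_left (g := g) (c := y₀')
      fun t ht => hg t (key t ht)
    exact ⟨t, key t ht, h⟩

lemma samePos_neg_iff {R : Set (ℝ × ℝ)} {y y' : ℝ} :
    SamePos ((fun z => -z) '' R) y y' ↔ SamePos R (-y) (-y') := by
  constructor
  · intro h z hz
    have := h (-z) ⟨z, hz, rfl⟩
    simp only [Prod.fst_neg, Prod.snd_neg] at this
    rw [neg_lt, lt_neg, neg_lt, lt_neg] at this
    exact ⟨lt_neg.trans (by rw [this.2]; exact lt_neg), neg_lt.trans (by rw [this.1]; exact neg_lt)⟩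
  · rintro h _ ⟨z, hz, rfl⟩
    have := h z hz
    simp only [Prod.fst_neg, Prod.snd_neg]
    exact ⟨neg_lt.trans (this.2.trans neg_lt), lt_neg.trans (this.1.trans lt_neg)⟩

open Polynomial in
lemma transfer_pos {R : Set (ℝ × ℝ)} (hfin : R.Finite) {f g : ℝ[X]} {y₀ y₀' : ℝ}
    (h₀ : SamePos R y₀ y₀') (hgap : ∀ z ∈ R, z.1 ≠ y₀)
    (hf : ∀ y, SamePos R y y₀' → 0 < f.derivative.eval y)
    (hg : ∀ y', SamePos R y₀ y' → 0 < g.derivative.eval y')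
    (hR : ∀ z ∈ R, SamePos R z.1 z.2)
    (hz : ∀ z ∈ R, SignType.sign (f.eval z.1) = SignType.sign (g.eval z.2))
    (hpos : ∃ y, SamePos R y y₀' ∧ 0 < f.eval y) :
    ∃ y', SamePos R y₀ y' ∧ 0 < g.eval y' := by
  obtain ⟨y, hy, hfy⟩ := hpos
  obtain ⟨y', hy', h⟩ := transfer_neg (R := (fun z => -z) '' R) (hfin.image _)
    (f := -(f.comp (-X))) (g := -(g.comp (-X))) (y₀ := -y₀) (y₀' := -y₀')
    (by rw [samePos_neg_iff]; simpa using h₀)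
    (by rintro _ ⟨z, hz, rfl⟩; simpa using hgap z hz)
    (by
      intro y hy
      rw [samePos_neg_iff, neg_neg] at hy
      simpa [derivative_comp] using hf _ hy)
    (by
      intro y hy
      rw [samePos_neg_iff, neg_neg] at hy
      simpa [derivative_comp] using hg _ hy)
    (by
      rintro _ ⟨z, hz, rfl⟩
      rw [samePos_neg_iff]; simpa using hR z hz)
    (by
      rintro _ ⟨z, hzR, rfl⟩
      simp [Left.sign_neg, hz z hzR])
    ⟨-y, by rw [samePos_neg_iff]; simpa using hy, by simpa using hfy⟩
  rw [samePos_neg_iff, neg_neg] at hy'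
  exact ⟨-y', hy', by simpa using h⟩

lemma SamePos.between {R : Set (ℝ × ℝ)} {a b t c : ℝ} (ha : SamePos R a c) (hb : SamePos R b c)
    (hat : a ≤ t) (htb : t ≤ b) : SamePos R t c := fun z hz =>
  ⟨⟨fun h => (hb z hz).1.1 (h.trans_le htb), fun h => ((ha z hz).1.2 h).trans_le hat⟩,
    ⟨fun h => (ha z hz).2.1 (hat.trans_lt h), fun h => htb.trans_lt ((hb z hz).2.2 h)⟩⟩

lemma SamePos.between' {R : Set (ℝ × ℝ)} {a b t c : ℝ} (ha : SamePos R c a) (hb : SamePos R c b)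
    (hat : a ≤ t) (htb : t ≤ b) : SamePos R c t :=
  (SamePos.between ha.swap hb.swap hat htb).of_swap

lemma eventually_samePos {R : Set (ℝ × ℝ)} (hfin : R.Finite) {y y' : ℝ} (hy : SamePos R y y')
    (hgap : ∀ z ∈ R, z.1 ≠ y) : ∀ᶠ t in nhds y, SamePos R t y' := by
  have : ∀ᶠ t in nhds y, ∀ z ∈ R, (z.1 < t ↔ z.2 < y') ∧ (t < z.1 ↔ y' < z.2) := by
    rw [Filter.eventually_all_finite hfin]
    intro z hz
    have a := hy z hz
    rcases lt_or_gt_of_ne (hgap z hz) with hlt | hlt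
    · filter_upwards [lt_mem_nhds hlt] with t ht
      exact ⟨iff_of_true ht (a.1.1 hlt), iff_of_false ht.not_gt (a.1.1 hlt).not_gt⟩
    · filter_upwards [gt_mem_nhds hlt] with t ht
      exact ⟨iff_of_false ht.not_gt (a.2.1 hlt).not_gt, iff_of_true ht (a.2.1 hlt)⟩
  exact this

open Polynomial in
/-- The paired roots of `f` and `g` added to `R`. -/
def addRoots (R : Set (ℝ × ℝ)) (f g : ℝ[X]) : Set (ℝ × ℝ) :=
  R ∪ {u | f.eval u.1 = 0 ∧ g.eval u.2 = 0 ∧ SamePos R u.1 u.2}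

open Polynomial in
lemma swap_image_addRoots (R : Set (ℝ × ℝ)) (f g : ℝ[X]) :
    Prod.swap '' addRoots R f g = addRoots (Prod.swap '' R) g f := by
  ext ⟨a, b⟩
  simp only [addRoots, image_union, mem_union]
  refine or_congr Iff.rfl ?_
  simp only [mem_image, mem_ofPred_eq, Prod.exists, Prod.swap_prod_mk, Prod.mk.injEq]
  constructor
  · rintro ⟨x, y, ⟨h1, h2, h3⟩, rfl, rfl⟩
    exact ⟨h2, h1, h3.swap⟩
  · rintro ⟨h1, h2, h3⟩
    exact ⟨b, a, ⟨h2, h1, h3.of_swap⟩, rfl, rfl⟩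

open Polynomial in
/-- Data on which the roots of a pair of polynomials can be matched. -/
structure RootStep (R : Set (ℝ × ℝ)) (f g : ℝ[X]) : Prop where
  finite : R.Finite
  chain : ∀ z ∈ R, SamePos R z.1 z.2
  deriv : ∀ y y', SamePos R y y' →
    SignType.sign (f.derivative.eval y) = SignType.sign (g.derivative.eval y')
  ends : ∀ z ∈ R, SignType.sign (f.eval z.1) = SignType.sign (g.eval z.2)
  left_ne : f.derivative ≠ 0
  right_ne : g.derivative ≠ 0

namespace RootStep
open Polynomial

variable {R : Set (ℝ × ℝ)} {f g : ℝ[X]}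

lemma swap (h : RootStep R f g) : RootStep (Prod.swap '' R) g f where
  finite := h.finite.image _
  chain := by rintro _ ⟨z, hz, rfl⟩; exact (h.chain z hz).swap
  deriv y y' hy := (h.deriv y' y hy.of_swap).symm
  ends := by rintro _ ⟨z, hz, rfl⟩; exact (h.ends z hz).symm
  left_ne := h.right_ne
  right_ne := h.left_ne

lemma neg (h : RootStep R f g) : RootStep R (-f) (-g) where
  finite := h.finite
  chain := h.chain
  deriv y y' hy := by simp [Left.sign_neg, h.deriv y y' hy]
  ends z hz := by simp [Left.sign_neg, h.ends z hz]
  left_ne := by simpa using h.left_ne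
  right_ne := by simpa using h.right_ne

lemma lt_of_lt (h : RootStep R f g) {u w : ℝ × ℝ} (hu : SamePos R u.1 u.2)
    (hw : SamePos R w.1 w.2) (hfu : f.eval u.1 = 0) (hfw : f.eval w.1 = 0) (huw : u.1 < w.1) :
    u.2 < w.2 := by
  by_cases hsep : ∃ z ∈ R, u.1 ≤ z.1 ∧ z.1 ≤ w.1
  · obtain ⟨z, hz, h1, h2⟩ := hsep
    have a := hu z hz
    have b := hw z hz
    have a' := hu.eq_iff hz
    have b' := hw.eq_iff hz
    rcases h1.lt_or_eq with h1 | h1 <;> rcases h2.lt_or_eq with h2 | h2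
    · exact (a.2.1 h1).trans (b.1.1 h2)
    · exact (b'.1 h2) ▸ a.2.1 h1
    · exact (a'.1 h1.symm) ▸ b.1.1 h2
    · exact absurd (h1.trans h2) huw.ne
  · exfalso
    push Not at hsep
    obtain ⟨c, hc, hc0⟩ := exists_deriv_eq_zero huw f.continuous.continuousOn (hfu.trans hfw.symm)
    rw [Polynomial.deriv] at hc0
    have key : ∀ t ∈ Ioo u.1 w.1, SamePos R t u.2 := by
      intro t ht z hz
      have a := hu z hz
      have b := hsep z hz
      constructor
      · refine ⟨fun h' => a.1.1 ?_, fun h' => (a.1.2 h').trans ht.1⟩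
        by_contra! hcc
        exact absurd (b hcc) (not_lt.2 (h'.le.trans ht.2.le))
      · refine ⟨fun h' => a.2.1 (ht.1.trans h'), fun h' => ht.2.trans (b (a.2.2 h').le)⟩
    have hs := h.deriv c u.2 (key c hc)
    refine h.left_ne (eq_zero_of_infinite_isRoot _ ((Ioo_infinite huw).mono fun t ht => ?_))
    have := h.deriv t u.2 (key t ht)
    rw [← hs, hc0, sign_zero, sign_eq_zero_iff] at this
    exact this

lemma chain_addRoots (h : RootStep R f g) :
    ∀ z ∈ addRoots R f g, SamePos (addRoots R f g) z.1 z.2 := by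
  intro z hz w hw
  rcases hw with hw | hw
  · rcases hz with hz | hz
    · exact h.chain z hz w hw
    · exact hz.2.2 w hw
  · rcases hz with hz | hz
    · exact ⟨(hw.2.2 z hz).2, (hw.2.2 z hz).1⟩
    · constructor
      · exact ⟨h.lt_of_lt hw.2.2 hz.2.2 hw.1 hz.1,
          h.swap.lt_of_lt (u := w.swap) (w := z.swap) hw.2.2.swap hz.2.2.swap hw.2.1 hz.2.1⟩
      · exact ⟨h.lt_of_lt hz.2.2 hw.2.2 hz.1 hw.1,
          h.swap.lt_of_lt (u := z.swap) (w := w.swap) hz.2.2.swap hw.2.2.swap hz.2.1 hw.2.1⟩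

lemma derivative_ne_zero_of_gap (h : RootStep R f g) {y y' : ℝ} (hy : SamePos R y y')
    (hgap : ∀ z ∈ R, z.1 ≠ y) : f.derivative.eval y ≠ 0 := by
  intro h0
  have hs := h.deriv y y' hy
  rw [h0, sign_zero] at hs
  have hopen := eventually_samePos h.finite hy hgap
  refine h.left_ne (eq_zero_of_infinite_isRoot _ ((infinite_of_mem_nhds y hopen).mono fun t ht => ?_))
  have := h.deriv t y' ht
  rw [← hs, sign_eq_zero_iff] at this
  exact this

lemma gap_pos (h : RootStep R f g) {y y' : ℝ} (hy : SamePos R y y')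
    (hpos : 0 < f.derivative.eval y) :
    (∀ t, SamePos R t y' → 0 < f.derivative.eval t) ∧
      ∀ t, SamePos R y t → 0 < g.derivative.eval t := by
  have hs := h.deriv y y' hy
  rw [sign_pos hpos] at hs
  refine ⟨fun t ht => ?_, fun t ht => ?_⟩
  · have := h.deriv t y' ht
    rwa [← hs, sign_eq_one_iff] at this
  · have := h.deriv y t ht
    rwa [sign_pos hpos, eq_comm, sign_eq_one_iff] at this

lemma exists_root_of_neg_of_pos {f : ℝ[X]} {y' a b : ℝ} (ha : SamePos R a y')
    (hb : SamePos R b y') (hfa : f.eval a < 0) (hfb : 0 < f.eval b) (hab : a ≤ b) :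
    ∃ u, SamePos R u y' ∧ f.eval u = 0 ∧ a < u ∧ u < b := by
  obtain ⟨u, hu, hu0⟩ := intermediate_value_Ioo hab f.continuous.continuousOn ⟨hfa, hfb⟩
  exact ⟨u, ha.between hb hu.1.le hu.2.le, hu0, hu.1, hu.2⟩

lemma strictMonoOn_gap {f : ℝ[X]} {y' : ℝ}
    (hf : ∀ t, SamePos R t y' → 0 < f.derivative.eval t) {a b : ℝ} (ha : SamePos R a y')
    (hb : SamePos R b y') (hab : a < b) : f.eval a < f.eval b := by
  have : StrictMonoOn (fun x => f.eval x) (Icc a b) := by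
    apply strictMonoOn_of_deriv_pos (convex_Icc _ _) f.continuous.continuousOn
    intro x hx
    rw [interior_Icc] at hx
    simpa using hf x (ha.between hb hx.1.le hx.2.le)
  exact this (left_mem_Icc.2 hab.le) (right_mem_Icc.2 hab.le) hab

lemma exists_lt_gap (h : RootStep R f g) {y y' : ℝ} (hy : SamePos R y y')
    (hgap : ∀ z ∈ R, z.1 ≠ y) : (∃ t < y, SamePos R t y') ∧ ∃ t > y, SamePos R t y' := by
  have hopen := eventually_samePos h.finite hy hgap
  obtain ⟨t, ht, ht'⟩ := ((hopen.filter_mono nhdsWithin_le_nhds).and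
    (self_mem_nhdsWithin (s := Iio y))).exists
  obtain ⟨s, hs, hs'⟩ := ((hopen.filter_mono nhdsWithin_le_nhds).and
    (self_mem_nhdsWithin (s := Ioi y))).exists
  exact ⟨⟨t, ht', ht⟩, ⟨s, hs', hs⟩⟩


lemma exists_neg_pos (h : RootStep R f g) {y y' : ℝ} (hy : SamePos R y y')
    (hgap : ∀ z ∈ R, z.1 ≠ y) (hpos : 0 < f.derivative.eval y) :
    ((∃ t, SamePos R t y' ∧ f.eval t < 0) → ∃ t, SamePos R y t ∧ g.eval t < 0) ∧
      ((∃ t, SamePos R t y' ∧ 0 < f.eval t) → ∃ t, SamePos R y t ∧ 0 < g.eval t) := by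
  obtain ⟨h1, h2⟩ := h.gap_pos hy hpos
  exact ⟨transfer_neg h.finite hy hgap h1 h2 h.chain h.ends,
    transfer_pos h.finite hy hgap h1 h2 h.chain h.ends⟩

lemma gap_swap {y y' : ℝ} (hy : SamePos R y y') (hgap : ∀ z ∈ R, z.1 ≠ y) :
    ∀ z ∈ Prod.swap '' R, z.1 ≠ y' := by
  rintro _ ⟨z, hz, rfl⟩ h
  exact hgap z hz ((hy.eq_iff hz).2 h)

lemma deriv_pos_right (h : RootStep R f g) {y y' : ℝ} (hy : SamePos R y y')
    (hpos : 0 < f.derivative.eval y) : 0 < g.derivative.eval y' :=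
  (h.gap_pos hy hpos).2 y' hy

lemma samePos_of_addRoots {y y' : ℝ} (hy : SamePos (addRoots R f g) y y') : SamePos R y y' :=
  fun z hz => hy z (Or.inl hz)

lemma eval_eq_zero (h : RootStep R f g) {y y' : ℝ} (hy : SamePos (addRoots R f g) y y')
    (hgap : ∀ z ∈ R, z.1 ≠ y) (hpos : 0 < f.derivative.eval y) (h0 : f.eval y = 0) :
    g.eval y' = 0 := by
  have hyR := samePos_of_addRoots hy
  obtain ⟨h1, h2⟩ := h.gap_pos hyR hpos
  obtain ⟨⟨t, hty, ht⟩, ⟨s, hsy, hs⟩⟩ := h.exists_lt_gap hyR hgap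
  obtain ⟨h3, h4⟩ := h.exists_neg_pos hyR hgap hpos
  obtain ⟨t', ht', hgt⟩ := h3 ⟨t, ht, h0 ▸ strictMonoOn_gap h1 ht hyR hty⟩
  obtain ⟨s', hs', hgs⟩ := h4 ⟨s, hs, by have := strictMonoOn_gap h1 hyR hs hsy; rwa [h0] at this⟩
  have hts : t' ≤ s' := by
    by_contra! hc
    have := strictMonoOn_gap (R := Prod.swap '' R) (f := g) (y' := y)
      (fun t ht => h2 t ht.of_swap) hs'.swap ht'.swap hc
    linarith
  obtain ⟨u', hu', hu0, -⟩ := exists_root_of_neg_of_pos ht'.swap hs'.swap hgt hgs hts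
  rw [← (hy.eq_iff (z := (y, u')) (Or.inr ⟨h0, hu0, hu'.of_swap⟩)).1 rfl]
  exact hu0

lemma eval_neg (h : RootStep R f g) {y y' : ℝ} (hy : SamePos (addRoots R f g) y y')
    (hgap : ∀ z ∈ R, z.1 ≠ y) (hpos : 0 < f.derivative.eval y) (h0 : f.eval y < 0) :
    g.eval y' < 0 := by
  have hyR := samePos_of_addRoots hy
  obtain ⟨h1, h2⟩ := h.gap_pos hyR hpos
  obtain ⟨t', ht', hgt⟩ := (h.exists_neg_pos hyR hgap hpos).1 ⟨y, hyR, h0⟩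
  by_contra! hc
  have h2' : ∀ t, SamePos (Prod.swap '' R) t y → 0 < g.derivative.eval t :=
    fun t ht => h2 t ht.of_swap
  have hty : t' ≤ y' := by
    by_contra! hlt
    have := strictMonoOn_gap h2' hyR.swap ht'.swap hlt
    linarith
  obtain ⟨u', ⟨hu1, hu2⟩, hu0⟩ := intermediate_value_Icc hty g.continuous.continuousOn ⟨hgt.le, hc⟩
  have hu' : SamePos R y u' := ht'.between' hyR hu1 hu2
  have hgap' := gap_swap hyR hgap
  obtain ⟨-, ⟨s', hs, hs'⟩⟩ := h.swap.exists_lt_gap hyR.swap hgap'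
  have hgs := strictMonoOn_gap h2' hyR.swap hs' hs
  obtain ⟨s, hs1, hfs⟩ := (h.swap.exists_neg_pos hyR.swap hgap' (h.deriv_pos_right hyR hpos)).2
    ⟨s', hs', hc.trans_lt hgs⟩
  have hs1' := hs1.of_swap
  have hys : y ≤ s := by
    by_contra! hlt
    have := strictMonoOn_gap h1 hs1' hyR hlt
    linarith
  obtain ⟨u, hu, hfu, hyu, -⟩ := exists_root_of_neg_of_pos hyR hs1' h0 hfs hys
  have := (hy (u, u') (Or.inr ⟨hfu, hu0, hyR.exchange hu' hu⟩)).2.1 hyu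
  exact absurd this (not_lt.2 hu2)

lemma sign_eq_of_pos (h : RootStep R f g) {y y' : ℝ} (hy : SamePos (addRoots R f g) y y')
    (hgap : ∀ z ∈ R, z.1 ≠ y) (hpos : 0 < f.derivative.eval y) :
    SignType.sign (f.eval y) = SignType.sign (g.eval y') := by
  have hyR := samePos_of_addRoots hy
  have hgap' := gap_swap hyR hgap
  have hpos' := h.deriv_pos_right hyR hpos
  have hy' := hy.swap
  rw [swap_image_addRoots] at hy'
  rcases lt_trichotomy (f.eval y) 0 with h0 | h0 | h0
  · rw [sign_neg h0, sign_neg (h.eval_neg hy hgap hpos h0)]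
  · rw [h0, h.eval_eq_zero hy hgap hpos h0]
  · rcases lt_trichotomy (g.eval y') 0 with h1 | h1 | h1
    · exact absurd (h.swap.eval_neg hy' hgap' hpos' h1) h0.not_gt
    · exact absurd (h.swap.eval_eq_zero hy' hgap' hpos' h1) h0.ne'
    · rw [sign_pos h0, sign_pos h1]

lemma addRoots_neg : addRoots R (-f) (-g) = addRoots R f g := by
  simp [addRoots]

lemma sign_eq (h : RootStep R f g) {y y' : ℝ} (hy : SamePos (addRoots R f g) y y') :
    SignType.sign (f.eval y) = SignType.sign (g.eval y') := by
  have hyR := samePos_of_addRoots hy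
  by_cases hgap : ∀ z ∈ R, z.1 ≠ y
  · rcases lt_or_gt_of_ne (h.derivative_ne_zero_of_gap hyR hgap) with hlt | hlt
    · have := h.neg.sign_eq_of_pos (y := y) (y' := y') (by rwa [addRoots_neg]) hgap (by simpa using hlt)
      simpa [Left.sign_neg] using this
    · exact h.sign_eq_of_pos hy hgap hlt
  · push Not at hgap
    obtain ⟨z, hz, rfl⟩ := hgap
    rw [← (hyR.eq_iff hz).1 rfl]
    exact h.ends z hz

lemma finite_addRoots (h : RootStep R f g) : (addRoots R f g).Finite := by
  have hf : f ≠ 0 := by rintro rfl; exact h.left_ne (by simp)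
  have hg : g ≠ 0 := by rintro rfl; exact h.right_ne (by simp)
  refine h.finite.union (((finite_setOfPred_isRoot hf).prod (finite_setOfPred_isRoot hg)).subset ?_)
  rintro ⟨a, b⟩ ⟨h1, h2, -⟩
  exact ⟨h1, h2⟩

end RootStep

section Elimination
open Polynomial

variable {A : Type*} [CommRing A]

lemma exists_pseudoRem (f p : A[X]) (hp : 0 < p.natDegree) :
    ∃ (k : ℕ) (q r : A[X]), C (p.leadingCoeff ^ k) * f = q * p + r ∧ r.natDegree < p.natDegree := by
  induction hn : f.natDegree using Nat.strong_induction_on generalizing f with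
  | _ n ih =>
    subst hn
    by_cases hlt : f.natDegree < p.natDegree
    · exact ⟨0, 0, f, by simp, hlt⟩
    · push Not at hlt
      obtain ⟨k, q, r, h, hr⟩ := ih _
        (natDegree_cancelLeads_lt_of_natDegree_le_natDegree hlt (hp.trans_le hlt)) _ rfl
      refine ⟨k + 1, q + C (p.leadingCoeff ^ k) * (C f.leadingCoeff * X ^ (f.natDegree - p.natDegree)),
        r, ?_, hr⟩
      have : C (p.leadingCoeff ^ (k + 1)) * f = C (p.leadingCoeff ^ k) * p.cancelLeads f +
          C (p.leadingCoeff ^ k) * (C f.leadingCoeff * X ^ (f.natDegree - p.natDegree)) * p := by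
        simp only [cancelLeads, Nat.sub_eq_zero_of_le hlt, pow_succ, C_mul]
        ring
      rw [this, h]
      ring

open Classical in
/-- A pseudo-remainder of `f` by `p`. -/
noncomputable def pseudoRem (f p : A[X]) : A[X] :=
  if hp : 0 < p.natDegree then (exists_pseudoRem f p hp).choose_spec.choose_spec.choose else 0

lemma pseudoRem_spec (f p : A[X]) (hp : 0 < p.natDegree) :
    (∃ (k : ℕ) (q : A[X]), C (p.leadingCoeff ^ k) * f = q * p + pseudoRem f p) ∧
      (pseudoRem f p).natDegree < p.natDegree := by
  have h := (exists_pseudoRem f p hp).choose_spec.choose_spec.choose_spec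
  rw [pseudoRem, dif_pos hp]
  exact ⟨⟨_, _, h.1⟩, h.2⟩

/-- A family of polynomials closed under the operations used to eliminate the variable. -/
structure ElimClosed (s : Finset A[X]) : Prop where
  deriv : ∀ f ∈ s, 0 < f.natDegree → derivative f ∈ s
  erase : ∀ f ∈ s, 0 < f.natDegree → f.eraseLead ∈ s
  rem : ∀ f ∈ s, ∀ p ∈ s, 0 < p.natDegree → p.natDegree ≤ f.natDegree → pseudoRem f p ∈ s

lemma natDegree_derivative_le_sub (f : A[X]) : f.derivative.natDegree ≤ f.natDegree - 1 :=
  natDegree_derivative_le f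

lemma exists_elimClosed_aux (d : ℕ) : ∀ (Top L : Finset A[X]), (∀ p ∈ L, p.natDegree ≤ d) →
    ∃ L' : Finset A[X], L ⊆ L' ∧ (∀ p ∈ L', p.natDegree ≤ d) ∧ ElimClosed L' ∧
      ∀ f ∈ Top, ∀ p ∈ L', 0 < p.natDegree → pseudoRem f p ∈ L' := by
  classical
  induction d with
  | zero =>
    intro Top L hL
    refine ⟨L, subset_rfl, hL, ⟨?_, ?_, ?_⟩, ?_⟩
    · intro f hf h; exact absurd (hL f hf) (by omega)
    · intro f hf h; exact absurd (hL f hf) (by omega)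
    · intro f _ p hp h; exact absurd (hL p hp) (by omega)
    · intro f _ p hp h; exact absurd (hL p hp) (by omega)
  | succ d ih =>
    intro Top L hL
    set D := L.filter (fun p => p.natDegree = d + 1) with hD
    obtain ⟨L', hL', hdeg, hcl, htop⟩ := ih (Top ∪ D)
      (L.filter (fun p => p.natDegree ≤ d) ∪ D.image derivative ∪ D.image eraseLead ∪
        ((Top ∪ D) ×ˢ D).image (fun u => pseudoRem u.1 u.2)) (by
        intro p hp
        simp only [Finset.mem_union, Finset.mem_filter, Finset.mem_image, Finset.mem_product,
          Prod.exists, hD] at hp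
        rcases hp with ((⟨-, h⟩ | ⟨q, ⟨-, h⟩, rfl⟩) | ⟨q, ⟨-, h⟩, rfl⟩) | ⟨f, q, ⟨-, -, h⟩, rfl⟩
        · exact h
        · have := natDegree_derivative_le_sub q; omega
        · have := eraseLead_natDegree_le q; omega
        · have := (pseudoRem_spec f q (by omega)).2; omega)
    have hDdeg : ∀ p ∈ D, p.natDegree = d + 1 := fun p hp => (Finset.mem_filter.1 hp).2
    have hrem : ∀ f ∈ Top ∪ D, ∀ p ∈ D, pseudoRem f p ∈ L' := fun f hf p hp =>
      hL' (Finset.mem_union_right _ (Finset.mem_image.2 ⟨(f, p), Finset.mem_product.2 ⟨hf, hp⟩, rfl⟩))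
    refine ⟨L' ∪ D, ?_, ?_, ⟨?_, ?_, ?_⟩, ?_⟩
    · intro p hp
      rcases (hL p hp).lt_or_eq with h | h
      · refine Finset.mem_union_left _ (hL' ?_)
        simp only [Finset.mem_union, Finset.mem_filter]
        exact Or.inl (Or.inl (Or.inl ⟨hp, by omega⟩))
      · exact Finset.mem_union_right _ (Finset.mem_filter.2 ⟨hp, h⟩)
    · intro p hp
      rcases Finset.mem_union.1 hp with h | h
      · exact (hdeg p h).trans (by omega)
      · exact (hDdeg p h).le
    · intro f hf h
      refine Finset.mem_union_left _ ?_
      rcases Finset.mem_union.1 hf with h' | h'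
      · exact hcl.deriv f h' h
      · refine hL' ?_
        simp only [Finset.mem_union]
        exact Or.inl (Or.inl (Or.inr (Finset.mem_image_of_mem _ h')))
    · intro f hf h
      refine Finset.mem_union_left _ ?_
      rcases Finset.mem_union.1 hf with h' | h'
      · exact hcl.erase f h' h
      · refine hL' ?_
        simp only [Finset.mem_union]
        exact Or.inl (Or.inr (Finset.mem_image_of_mem _ h'))
    · intro f hf p hp h0 hle
      refine Finset.mem_union_left _ ?_
      rcases Finset.mem_union.1 hp with hp' | hp' <;> rcases Finset.mem_union.1 hf with hf' | hf'
      · exact hcl.rem f hf' p hp' h0 hle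
      · exact htop f (Finset.mem_union_right _ hf') p hp' h0
      · exact absurd (hdeg f hf') (by have := hDdeg p hp'; omega)
      · exact hrem f (Finset.mem_union_right _ hf') p hp'
    · intro f hf p hp h0
      refine Finset.mem_union_left _ ?_
      rcases Finset.mem_union.1 hp with hp' | hp'
      · exact htop f (Finset.mem_union_left _ hf) p hp' h0
      · exact hrem f (Finset.mem_union_left _ hf) p hp'

lemma exists_elimClosed (L : Finset A[X]) : ∃ L' : Finset A[X], L ⊆ L' ∧ ElimClosed L' := by
  obtain ⟨L', h1, -, h2, -⟩ := exists_elimClosed_aux (L.sup natDegree) ∅ L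
    (fun p hp => Finset.le_sup (f := natDegree) hp)
  exact ⟨L', h1, h2⟩

lemma map_eq_map_eraseLead {φ : A →+* ℝ} {f : A[X]} (h : φ f.leadingCoeff = 0) :
    f.map φ = f.eraseLead.map φ := by
  calc f.map φ = (f.eraseLead + C f.leadingCoeff * X ^ f.natDegree).map φ := by
        rw [eraseLead_add_C_mul_X_pow]
    _ = f.eraseLead.map φ := by
        rw [Polynomial.map_add, Polynomial.map_mul, map_C, h]; simp

lemma sign_eval_eq_of_root {φ ψ : A →+* ℝ} {f p : A[X]} (hp : 0 < p.natDegree)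
    (hlc : φ p.leadingCoeff ≠ 0)
    (hsign : SignType.sign (φ p.leadingCoeff) = SignType.sign (ψ p.leadingCoeff)) {z z' : ℝ}
    (hz : (p.map φ).eval z = 0) (hz' : (p.map ψ).eval z' = 0)
    (hrem : SignType.sign (((pseudoRem f p).map φ).eval z) =
      SignType.sign (((pseudoRem f p).map ψ).eval z')) :
    SignType.sign ((f.map φ).eval z) = SignType.sign ((f.map ψ).eval z') := by
  obtain ⟨⟨k, q, h⟩, -⟩ := pseudoRem_spec f p hp
  have h1 : φ p.leadingCoeff ^ k * (f.map φ).eval z = ((pseudoRem f p).map φ).eval z := by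
    have := congrArg (fun t => (t.map φ).eval z) h
    simpa [hz] using this
  have h2 : ψ p.leadingCoeff ^ k * (f.map ψ).eval z' = ((pseudoRem f p).map ψ).eval z' := by
    have := congrArg (fun t => (t.map ψ).eval z') h
    simpa [hz'] using this
  rw [← h1, ← h2, sign_mul, sign_mul, sign_pow, sign_pow, ← hsign] at hrem
  exact mul_left_cancel₀ (pow_ne_zero _ (sign_ne_zero.2 hlc)) hrem

/-- Two specialisations giving the coefficients of an elimination-closed family the same signs
have matching real root configurations. -/
lemma exists_matching (s : Finset A[X]) : ElimClosed s → ∀ φ ψ : A →+* ℝ,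
    (∀ p ∈ s, ∀ k, SignType.sign (φ (p.coeff k)) = SignType.sign (ψ (p.coeff k))) →
    ∃ R : Set (ℝ × ℝ), R.Finite ∧ (∀ z ∈ R, SamePos R z.1 z.2) ∧
      (∀ z ∈ R, ∃ p ∈ s, 0 < p.natDegree ∧ φ p.leadingCoeff ≠ 0 ∧
        (p.map φ).eval z.1 = 0 ∧ (p.map ψ).eval z.2 = 0) ∧
      ∀ p ∈ s, ∀ y y', SamePos R y y' →
        SignType.sign ((p.map φ).eval y) = SignType.sign ((p.map ψ).eval y') := by
  classical
  refine Finset.induction_on_max_value natDegree s ?_ ?_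
  · intro _ φ ψ _; exact ⟨∅, finite_empty, by simp [SamePos], by simp, by simp⟩
  · intro a s has hmax ih hcl φ ψ hsign
    have hdrop : ∀ g ∈ insert a s, g.natDegree < a.natDegree → g ∈ s := fun g hg hlt =>
      (Finset.mem_insert.1 hg).resolve_left (by rintro rfl; exact lt_irrefl _ hlt)
    have hcl' : ElimClosed s := by
      refine ⟨fun f hf h => ?_, fun f hf h => ?_, fun f hf p hp h h' => ?_⟩
      · refine hdrop _ (hcl.deriv f (Finset.mem_insert_of_mem hf) h) ?_
        have := natDegree_derivative_le_sub f; have := hmax f hf; omega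
      · refine hdrop _ (hcl.erase f (Finset.mem_insert_of_mem hf) h) ?_
        have := eraseLead_natDegree_le f; have := hmax f hf; omega
      · refine hdrop _ (hcl.rem f (Finset.mem_insert_of_mem hf) p (Finset.mem_insert_of_mem hp) h h') ?_
        have := (pseudoRem_spec f p h).2; have := hmax p hp; omega
    obtain ⟨R, hfin, hchain, hroot, hcompat⟩ := ih hcl' φ ψ
      (fun p hp => hsign p (Finset.mem_insert_of_mem hp))
    have hroot' : ∀ z ∈ R, ∃ p ∈ insert a s, 0 < p.natDegree ∧ φ p.leadingCoeff ≠ 0 ∧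
        (p.map φ).eval z.1 = 0 ∧ (p.map ψ).eval z.2 = 0 := fun z hz => by
      obtain ⟨p, hp, h⟩ := hroot z hz
      exact ⟨p, Finset.mem_insert_of_mem hp, h⟩
    have hsa := hsign a (Finset.mem_insert_self _ _)
    by_cases hdeg : a.natDegree = 0
    · refine ⟨R, hfin, hchain, hroot', fun p hp y y' hy => ?_⟩
      rcases Finset.mem_insert.1 hp with rfl | hp
      · rw [eq_C_of_natDegree_eq_zero hdeg]
        simpa using hsa 0
      · exact hcompat p hp y y' hy
    have hdeg' : 0 < a.natDegree := Nat.pos_of_ne_zero hdeg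
    by_cases hlc : φ a.leadingCoeff = 0
    · have hlc' : ψ a.leadingCoeff = 0 := by
        have := hsa a.natDegree
        rwa [coeff_natDegree, hlc, sign_zero, eq_comm, sign_eq_zero_iff] at this
      refine ⟨R, hfin, hchain, hroot', fun p hp y y' hy => ?_⟩
      rcases Finset.mem_insert.1 hp with rfl | hp
      · rw [map_eq_map_eraseLead hlc, map_eq_map_eraseLead hlc']
        refine hcompat _ (hdrop _ (hcl.erase p (Finset.mem_insert_self _ _) hdeg') ?_) y y' hy
        have := eraseLead_natDegree_le p; omega
      · exact hcompat p hp y y' hy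
    · have hlc' : ψ a.leadingCoeff ≠ 0 := by
        have := hsa a.natDegree
        rw [coeff_natDegree] at this
        rw [← sign_ne_zero, ← this, sign_ne_zero]
        exact hlc
      have hda : derivative a ∈ s := hdrop _ (hcl.deriv a (Finset.mem_insert_self _ _) hdeg')
        (by have := natDegree_derivative_le_sub a; omega)
      have hne : ∀ χ : A →+* ℝ, χ a.leadingCoeff ≠ 0 → (a.map χ).derivative ≠ 0 := by
        intro χ hχ h0
        have h1 := derivative_eq_zero.1 h0
        rw [natDegree_map_of_leadingCoeff_ne_zero χ hχ] at h1
        exact hdeg h1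
      have hstep : RootStep R (a.map φ) (a.map ψ) :=
        { finite := hfin
          chain := hchain
          deriv := fun y y' hy => by
            rw [derivative_map, derivative_map]; exact hcompat _ hda y y' hy
          ends := fun z hz => by
            obtain ⟨p, hp, hp0, hplc, hz1, hz2⟩ := hroot z hz
            refine sign_eval_eq_of_root hp0 hplc ?_ hz1 hz2 (hcompat _ ?_ _ _ (hchain z hz))
            · exact hsign p (Finset.mem_insert_of_mem hp) p.natDegree
            · refine hdrop _ (hcl.rem a (Finset.mem_insert_self _ _) p
                (Finset.mem_insert_of_mem hp) hp0 (hmax p hp)) ?_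
              have := (pseudoRem_spec a p hp0).2; have := hmax p hp; omega
          left_ne := hne φ hlc
          right_ne := hne ψ hlc' }
      refine ⟨addRoots R (a.map φ) (a.map ψ), hstep.finite_addRoots, hstep.chain_addRoots, ?_, ?_⟩
      · rintro z (hz | hz)
        · exact hroot' z hz
        · exact ⟨a, Finset.mem_insert_self _ _, hdeg', hlc, hz.1, hz.2.1⟩
      · intro p hp y y' hy
        rcases Finset.mem_insert.1 hp with rfl | hp
        · exact hstep.sign_eq hy
        · exact hcompat p hp y y' (RootStep.samePos_of_addRoots hy)

/-- The sign vectors realised by a finite family of univariate polynomials are determined by the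
signs of finitely many polynomials in the coefficients. -/
lemma exists_sign_elimination (L : Finset A[X]) : ∃ T : Finset A, ∀ φ ψ : A →+* ℝ,
    (∀ t ∈ T, SignType.sign (φ t) = SignType.sign (ψ t)) → ∀ y, ∃ y', ∀ p ∈ L,
      SignType.sign ((p.map φ).eval y) = SignType.sign ((p.map ψ).eval y') := by
  classical
  obtain ⟨s, hLs, hs⟩ := exists_elimClosed L
  refine ⟨s.biUnion coeffs, fun φ ψ h y => ?_⟩
  obtain ⟨R, hfin, hchain, -, hcompat⟩ := exists_matching s hs φ ψ (fun p hp k => by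
    by_cases hk : p.coeff k = 0
    · simp [hk]
    · exact h _ (Finset.mem_biUnion.2 ⟨p, hp, coeff_mem_coeffs hk⟩))
  obtain ⟨y', hy'⟩ := exists_samePos hfin hchain y
  exact ⟨y', fun p hp => hcompat p (hLs hp) y y' hy'⟩

end Elimination

section SemialgebraicPredicates
open MvPolynomial

lemma MvPolynomial.eval_map_optionEquivLeft {ι : Type*} (x : ι → ℝ) (y : ℝ)
    (t : MvPolynomial (Option ι) ℝ) :
    ((optionEquivLeft ℝ ι t).map (eval x)).eval y = eval (fun o => o.elim y x) t := by
  induction t using MvPolynomial.induction_on with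
  | C a => simp [optionEquivLeft_C]
  | add p q hp hq => simp [hp, hq]
  | mul_X p o hp =>
    rw [map_mul, Polynomial.map_mul, Polynomial.eval_mul, hp, map_mul]
    cases o <;> simp [optionEquivLeft_X_none, optionEquivLeft_X_some]

/-- A predicate on `ι → ℝ` decided by the signs of finitely many polynomials. -/
def SA {ι : Type*} (P : (ι → ℝ) → Prop) : Prop :=
  ∃ T : Finset (MvPolynomial ι ℝ), ∀ x y,
    (∀ t ∈ T, SignType.sign (eval x t) = SignType.sign (eval y t)) → (P x ↔ P y)

namespace SA

variable {ι κ : Type*} {P Q : (ι → ℝ) → Prop}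

lemma congr (hP : SA P) (h : ∀ x, P x ↔ Q x) : SA Q := by
  have : P = Q := funext fun x => propext (h x)
  exact this ▸ hP

lemma const (p : Prop) : SA fun _ : ι → ℝ => p := ⟨∅, fun _ _ _ => Iff.rfl⟩

lemma not (hP : SA P) : SA fun x => ¬ P x := by
  obtain ⟨T, hT⟩ := hP
  exact ⟨T, fun x y h => not_congr (hT x y h)⟩

lemma and (hP : SA P) (hQ : SA Q) : SA fun x => P x ∧ Q x := by
  classical
  obtain ⟨T, hT⟩ := hP
  obtain ⟨T', hT'⟩ := hQ
  exact ⟨T ∪ T', fun x y h => and_congr (hT x y fun t ht => h t (Finset.mem_union_left _ ht))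
    (hT' x y fun t ht => h t (Finset.mem_union_right _ ht))⟩

lemma forall_finite [Finite κ] {P : κ → (ι → ℝ) → Prop} (h : ∀ k, SA (P k)) :
    SA fun x => ∀ k, P k x := by
  classical
  cases nonempty_fintype κ
  choose T hT using h
  exact ⟨Finset.univ.biUnion T, fun x y h => forall_congr' fun k => hT k x y fun t ht =>
    h t (Finset.mem_biUnion.2 ⟨k, Finset.mem_univ _, ht⟩)⟩

lemma exists_finite [Finite κ] {P : κ → (ι → ℝ) → Prop} (h : ∀ k, SA (P k)) :
    SA fun x => ∃ k, P k x :=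
  (forall_finite fun k => (h k).not).not.congr fun x => by simp

lemma eval_eq_zero (p : MvPolynomial ι ℝ) : SA fun x => eval x p = 0 :=
  ⟨{p}, fun x y h => by
    have := h p (Finset.mem_singleton_self _)
    show _ = _ ↔ _ = _
    rw [← sign_eq_zero_iff, this, sign_eq_zero_iff]⟩

lemma eval_pos (p : MvPolynomial ι ℝ) : SA fun x => 0 < eval x p :=
  ⟨{p}, fun x y h => by
    have := h p (Finset.mem_singleton_self _)
    show _ < _ ↔ _ < _
    rw [← sign_eq_one_iff, this, sign_eq_one_iff]⟩

lemma eval_eq (p q : MvPolynomial ι ℝ) : SA fun x => eval x p = eval x q :=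
  (eval_eq_zero (p - q)).congr fun x => by rw [map_sub, sub_eq_zero]

lemma eval_lt (p q : MvPolynomial ι ℝ) : SA fun x => eval x p < eval x q :=
  (eval_pos (q - p)).congr fun x => by rw [map_sub, sub_pos]

lemma coord_eq (i j : ι) : SA fun x : ι → ℝ => x i = x j :=
  (eval_eq (X i) (X j)).congr fun x => by simp

/-- Substitution of polynomials. -/
lemma comp_poly {P : (κ → ℝ) → Prop} (hP : SA P) (q : κ → MvPolynomial ι ℝ) :
    SA fun x => P fun k => eval x (q k) := by
  classical
  obtain ⟨T, hT⟩ := hP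
  have key : ∀ (x : ι → ℝ) (t : MvPolynomial κ ℝ),
      eval (fun k => eval x (q k)) t = eval x (bind₁ q t) := by
    intro x t
    exact (eval₂Hom_bind₁ (RingHom.id ℝ) x q t).symm
  refine ⟨T.image (bind₁ q), fun x y h => hT _ _ fun t ht => ?_⟩
  rw [key, key]
  exact h _ (Finset.mem_image_of_mem _ ht)

lemma comp {P : (κ → ℝ) → Prop} (hP : SA P) (e : κ → ι) : SA fun x => P fun k => x (e k) :=
  (hP.comp_poly fun k => X (e k)).congr fun x => by simp

lemma exists_one {P : (Option ι → ℝ) → Prop} (hP : SA P) :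
    SA fun x : ι → ℝ => ∃ y : ℝ, P fun o => o.elim y x := by
  classical
  obtain ⟨T, hT⟩ := hP
  obtain ⟨T', hT'⟩ := exists_sign_elimination (T.image (optionEquivLeft ℝ ι))
  have half : ∀ x x' : ι → ℝ, (∀ t ∈ T', SignType.sign (eval x t) = SignType.sign (eval x' t)) →
      (∃ y : ℝ, P fun o => o.elim y x) → ∃ y : ℝ, P fun o => o.elim y x' := by
    rintro x x' h ⟨y, hy⟩
    obtain ⟨y', hy'⟩ := hT' (eval x) (eval x') h y
    refine ⟨y', (hT _ _ fun t ht => ?_).1 hy⟩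
    rw [← eval_map_optionEquivLeft, ← eval_map_optionEquivLeft]
    exact hy' _ (Finset.mem_image_of_mem _ ht)
  exact ⟨T', fun x x' h => ⟨half x x' h, half x' x fun t ht => (h t ht).symm⟩⟩

/-- The Tarski–Seidenberg projection theorem. -/
lemma exists_sum (κ : Type) [Finite κ] : ∀ {P : (ι ⊕ κ → ℝ) → Prop}, SA P →
    SA fun x : ι → ℝ => ∃ y : κ → ℝ, P (Sum.elim x y) := by
  refine Finite.induction_empty_option
    (P := fun κ => ∀ {P : (ι ⊕ κ → ℝ) → Prop}, SA P →
      SA fun x : ι → ℝ => ∃ y : κ → ℝ, P (Sum.elim x y)) ?_ ?_ ?_ κ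
  · intro α β e h P hP
    refine (h (hP.comp (Sum.map id e.symm))).congr fun x => ?_
    constructor
    · rintro ⟨y, hy⟩
      refine ⟨y ∘ e.symm, ?_⟩
      convert hy using 1
      ext (i | i) <;> simp
    · rintro ⟨y, hy⟩
      refine ⟨y ∘ e, ?_⟩
      convert hy using 1
      ext (i | i) <;> simp
  · intro P hP
    refine (hP.comp (Sum.elim id PEmpty.elim)).congr fun x => ?_
    constructor
    · intro h
      refine ⟨PEmpty.elim, ?_⟩
      convert h using 1
      ext (i | i)
      · simp
      · exact i.elim
    · rintro ⟨y, hy⟩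
      convert hy using 1
      ext (i | i)
      · simp
      · exact i.elim
  · intro α _ h P hP
    refine (h (exists_one (hP.comp
      (Sum.elim (fun i => some (Sum.inl i)) fun o => o.elim none fun a => some (Sum.inr a))))).congr
      fun x => ?_
    constructor
    · rintro ⟨y, t, hy⟩
      refine ⟨fun o => o.elim t y, ?_⟩
      convert hy using 1
      ext (i | _ | i) <;> simp
    · rintro ⟨y, hy⟩
      refine ⟨fun a => y (some a), y none, ?_⟩
      convert hy using 1
      ext (i | _ | i) <;> simp

lemma exists_vec {κ : Type} [Finite κ] {P : (ι → ℝ) → (κ → ℝ) → Prop}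
    (hP : SA fun z : ι ⊕ κ → ℝ => P (fun i => z (Sum.inl i)) fun k => z (Sum.inr k)) :
    SA fun x => ∃ y, P x y :=
  (exists_sum κ hP).congr fun x => by simp

lemma exists_real {P : (ι → ℝ) → ℝ → Prop}
    (hP : SA fun z : Option ι → ℝ => P (fun i => z (some i)) (z none)) :
    SA fun x => ∃ y, P x y :=
  (exists_one hP).congr fun x => by simp

end SA

lemma isSemialgebraic_iff_sa {n : ℕ} {S : Set (Fin n → ℝ)} :
    IsSemialgebraic S ↔ SA fun x => x ∈ S := by
  classical
  constructor
  · rintro ⟨L, rfl⟩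
    have hb : ∀ b : MvPolynomial (Fin n) ℝ × List (MvPolynomial (Fin n) ℝ),
        SA fun x => x ∈ BasicSemialgebraic b.1 b.2 := fun b =>
      ((SA.eval_eq_zero b.1).and (SA.forall_finite (κ := {g // g ∈ b.2.toFinset})
        fun g => SA.eval_pos g.1)).congr fun x => by simp [BasicSemialgebraic]
    refine (SA.exists_finite (κ := {c // c ∈ L.toFinset}) (P := fun c x => ∀ b : {b // b ∈ c.1.toFinset},
      x ∈ BasicSemialgebraic b.1.1 b.1.2) fun c => SA.forall_finite fun b => hb b.1).congr fun x => ?_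
    simp
  · rintro ⟨T, hT⟩
    let pol : (T → SignType) → MvPolynomial (Fin n) ℝ := fun σ =>
      ∑ t : T, if σ t = 0 then t.1 ^ 2 else 0
    let ineq : (T → SignType) → List (MvPolynomial (Fin n) ℝ) := fun σ =>
      (Finset.univ.filter fun t => σ t = 1).toList.map (fun t : T => t.1) ++
        (Finset.univ.filter fun t => σ t = -1).toList.map (fun t : T => -t.1)
    have hmem : ∀ σ x, x ∈ BasicSemialgebraic (pol σ) (ineq σ) ↔
        ∀ t : T, SignType.sign (eval x t.1) = σ t := by
      intro σ x
      have h1 : eval x (pol σ) = 0 ↔ ∀ t : T, σ t = 0 → eval x t.1 = 0 := by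
        simp only [pol, map_sum]
        rw [Finset.sum_eq_zero_iff_of_nonneg]
        · refine forall_congr' fun t => ?_
          by_cases h : σ t = 0 <;> simp [h]
        · intro t _
          by_cases h : σ t = 0 <;> simp [h, sq_nonneg]
      have h2 : (∀ g ∈ ineq σ, 0 < eval x g) ↔
          (∀ t : T, σ t = 1 → 0 < eval x t.1) ∧ ∀ t : T, σ t = -1 → eval x t.1 < 0 := by
        simp only [ineq, List.mem_append, List.mem_map, Finset.mem_toList, Finset.mem_filter,
          Finset.mem_univ, true_and, or_imp, forall_and]
        refine and_congr ⟨fun h t ht => h _ ⟨t, ht, rfl⟩, ?_⟩ ⟨fun h t ht => ?_, ?_⟩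
        · rintro h _ ⟨t, ht, rfl⟩; exact h t ht
        · have := h _ ⟨t, ht, rfl⟩; simpa using this
        · rintro h _ ⟨t, ht, rfl⟩; simpa using h t ht
      change eval x (pol σ) = 0 ∧ (∀ g ∈ ineq σ, 0 < eval x g) ↔ _
      rw [h1, h2, ← forall_and, ← forall_and]
      refine forall_congr' fun t => ?_
      have hcases : σ t = 0 ∨ σ t = 1 ∨ σ t = -1 := by cases σ t <;> decide
      rcases hcases with h | h | h <;> simp [h, sign_eq_zero_iff, sign_eq_one_iff, sign_eq_neg_one_iff]
    let good : Finset (T → SignType) := Finset.univ.filter fun σ =>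
      ∃ x ∈ S, ∀ t : T, SignType.sign (eval x t.1) = σ t
    refine ⟨good.toList.map fun σ => [(pol σ, ineq σ)], ?_⟩
    ext x
    simp only [List.mem_map, Finset.mem_toList, mem_iUnion, mem_iInter]
    constructor
    · intro hx
      refine ⟨_, ⟨fun t => SignType.sign (eval x t.1),
        by simpa [good] using ⟨x, hx, fun _ _ => rfl⟩, rfl⟩, ?_⟩
      intro b hb
      rw [List.mem_singleton] at hb
      subst hb
      exact (hmem _ _).2 fun _ => rfl
    · rintro ⟨_, ⟨σ, hσ, rfl⟩, h⟩
      have h' := (hmem _ _).1 (h _ (List.mem_singleton_self _))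
      simp only [good, Finset.mem_filter, Finset.mem_univ, true_and] at hσ
      obtain ⟨y, hy, hy'⟩ := hσ
      exact (hT x y fun t ht => (h' ⟨t, ht⟩).trans (hy' ⟨t, ht⟩).symm).2 hy

end SemialgebraicPredicates

section SemialgebraicMaps
open MvPolynomial

/-- `F` has semialgebraic graph over `S`. -/
def SAGraph {ι κ : Type*} (S : Set (ι → ℝ)) (F : (ι → ℝ) → κ → ℝ) : Prop :=
  SA fun z : ι ⊕ κ → ℝ => (fun i => z (Sum.inl i)) ∈ S ∧
    F (fun i => z (Sum.inl i)) = fun k => z (Sum.inr k)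

/-- The real-valued function `h` has semialgebraic graph over `S`. -/
def SAFun {ι : Type*} (S : Set (ι → ℝ)) (h : (ι → ℝ) → ℝ) : Prop :=
  SA fun z : Option ι → ℝ => (fun i => z (some i)) ∈ S ∧ h (fun i => z (some i)) = z none

lemma isSemialgebraic_nashGraph_iff {n m : ℕ} {S : Set (Fin n → ℝ)}
    {f : (Fin n → ℝ) → (Fin m → ℝ)} : IsSemialgebraic (NashGraph S f) ↔ SAGraph S f := by
  rw [isSemialgebraic_iff_sa]
  constructor
  · intro h
    refine (h.comp finSumFinEquiv.symm).congr fun z => ?_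
    constructor
    · rintro ⟨x, hx, hz⟩
      have h1 : (fun i => z (Sum.inl i)) = x := by
        ext i; simpa using congrFun hz (Fin.castAdd m i)
      have h2 : (fun i => z (Sum.inr i)) = f x := by
        ext i; simpa using congrFun hz (Fin.natAdd n i)
      rw [h1, h2]
      exact ⟨hx, rfl⟩
    · rintro ⟨hx, hz⟩
      refine ⟨_, hx, ?_⟩
      rw [hz]
      ext i
      refine Fin.addCases (fun i => ?_) (fun i => ?_) i <;> simp
  · intro h
    refine (h.comp finSumFinEquiv).congr fun z => ?_
    constructor
    · rintro ⟨hx, hz⟩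
      refine ⟨_, hx, ?_⟩
      rw [hz]
      ext i
      refine Fin.addCases (fun i => ?_) (fun i => ?_) i <;> simp
    · rintro ⟨x, hx, rfl⟩
      simpa using hx

namespace SAGraph
variable {ι : Type*} {κ μ : Type} {S : Set (ι → ℝ)} {F : (ι → ℝ) → κ → ℝ}

lemma pullback [Finite κ] (hF : SAGraph S F) {Q : (ι → ℝ) → (κ → ℝ) → Prop}
    (hQ : SA fun z : ι ⊕ κ → ℝ => Q (fun i => z (Sum.inl i)) fun k => z (Sum.inr k)) :
    SA fun x => x ∈ S ∧ Q x (F x) :=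
  (SA.exists_vec (P := fun x y => (x ∈ S ∧ F x = y) ∧ Q x y) (hF.and hQ)).congr fun x => by
    constructor
    · rintro ⟨y, ⟨hx, rfl⟩, h⟩; exact ⟨hx, h⟩
    · rintro ⟨hx, h⟩; exact ⟨_, ⟨hx, rfl⟩, h⟩

lemma preimage [Finite κ] (hF : SAGraph S F) {Q : (κ → ℝ) → Prop} (hQ : SA Q) :
    SA fun x => x ∈ S ∧ Q (F x) :=
  hF.pullback (Q := fun _ y => Q y) (hQ.comp Sum.inr)

lemma restrict (hF : SAGraph S F) {T : Set (ι → ℝ)} (hT : SA fun x => x ∈ T) (h : T ⊆ S) :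
    SAGraph T F :=
  (SA.and hF (hT.comp Sum.inl)).congr fun z => by
    constructor
    · rintro ⟨⟨-, h1⟩, h2⟩; exact ⟨h2, h1⟩
    · rintro ⟨h1, h2⟩; exact ⟨⟨h h1, h2⟩, h1⟩

lemma of_poly (hS : SA fun x => x ∈ S) [Finite κ] (p : κ → MvPolynomial ι ℝ) :
    SAGraph S fun x k => eval x (p k) :=
  ((hS.comp Sum.inl).and (SA.forall_finite fun k =>
    (SA.eval_eq (rename Sum.inl (p k)) (X (Sum.inr k) : MvPolynomial (ι ⊕ κ) ℝ)))).congr fun z => by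
      simp only [eval_rename, eval_X, funext_iff]; rfl

lemma funComp [Finite κ] (hF : SAGraph S F) {T : Set (κ → ℝ)} {K : (κ → ℝ) → μ → ℝ}
    (hK : SAGraph T K) (hmaps : MapsTo F S T) : SAGraph S fun x => K (F x) := by
  refine (SA.exists_vec (ι := ι ⊕ μ) (κ := κ)
    (P := fun z y => ((fun i => z (Sum.inl i)) ∈ S ∧ F (fun i => z (Sum.inl i)) = y) ∧
      (y ∈ T ∧ K y = fun k => z (Sum.inr k)))
    ((hF.comp (Sum.map Sum.inl id)).and
      (hK.comp (Sum.elim Sum.inr fun k => Sum.inl (Sum.inr k))))).congr fun z => ?_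
  constructor
  · rintro ⟨y, ⟨h1, rfl⟩, -, h2⟩; exact ⟨h1, h2⟩
  · rintro ⟨h1, h2⟩; exact ⟨_, ⟨h1, rfl⟩, hmaps h1, h2⟩

lemma component [Finite κ] (hF : SAGraph S F) (k : κ) : SAFun S fun x => F x k := by
  refine (SA.exists_vec (ι := Option ι) (κ := κ)
    (P := fun z y => ((fun i => z (some i)) ∈ S ∧ F (fun i => z (some i)) = y) ∧ y k = z none)
    ((hF.comp (Sum.map some id)).and (SA.coord_eq (Sum.inr k) (Sum.inl none)))).congr fun z => ?_
  constructor
  · rintro ⟨y, ⟨h1, rfl⟩, h2⟩; exact ⟨h1, h2⟩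
  · rintro ⟨h1, h2⟩; exact ⟨_, ⟨h1, rfl⟩, h2⟩

lemma image {ι : Type} [Finite ι] {S : Set (ι → ℝ)} {F : (ι → ℝ) → κ → ℝ} (hF : SAGraph S F) :
    SA fun y => y ∈ F '' S := by
  refine (SA.exists_vec (ι := κ) (κ := ι) (P := fun y x => x ∈ S ∧ F x = y)
    (hF.comp Sum.swap)).congr fun y => ?_
  simp [mem_image]

end SAGraph

namespace SAFun
variable {ι : Type*} {κ : Type} {S : Set (ι → ℝ)}

lemma pi [Finite κ] (hS : SA fun x => x ∈ S) {F : (ι → ℝ) → κ → ℝ}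
    (hF : ∀ k, SAFun S fun x => F x k) : SAGraph S F :=
  ((hS.comp Sum.inl).and (SA.forall_finite fun k =>
    (hF k).comp fun o : Option ι => o.elim (Sum.inr k) Sum.inl)).congr fun z => by
      simp only [funext_iff]
      constructor
      · rintro ⟨h1, h2⟩; exact ⟨h1, fun k => (h2 k).2⟩
      · rintro ⟨h1, h2⟩; exact ⟨h1, fun k => ⟨h1, h2 k⟩⟩

lemma exists_and {h : (ι → ℝ) → ℝ} (hh : SAFun S h) {Q : (ι → ℝ) → ℝ → Prop}
    (hQ : SA fun z : Option ι → ℝ => Q (fun i => z (some i)) (z none)) :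
    SA fun x => x ∈ S ∧ Q x (h x) :=
  (SA.exists_real (P := fun x y => (x ∈ S ∧ h x = y) ∧ Q x y) (SA.and hh hQ)).congr fun x => by
    constructor
    · rintro ⟨y, ⟨hx, rfl⟩, h⟩; exact ⟨hx, h⟩
    · rintro ⟨hx, h⟩; exact ⟨_, ⟨hx, rfl⟩, h⟩

end SAFun

lemma SAGraph.eval_poly {ι : Type*} {κ : Type} [Finite κ] {S : Set (ι → ℝ)}
    {F : (ι → ℝ) → κ → ℝ} (hF : SAGraph S F) (p : MvPolynomial κ ℝ) :
    SAFun S fun x => eval (F x) p := by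
  have h := hF.funComp (SAGraph.of_poly (S := univ) (SA.const True) fun _ : Unit => p)
    (fun _ _ => mem_univ _)
  exact h.component ()

/-- The semialgebraic functions on `S`. -/
def saAlgebra {ι : Type*} (S : Set (ι → ℝ)) (hS : SA fun x => x ∈ S) : Subalgebra ℝ (S → ℝ) where
  carrier := {h | ∃ g, SAFun S g ∧ ∀ a : S, h a = g a.1}
  mul_mem' := by
    rintro h₁ h₂ ⟨g₁, hg₁, e₁⟩ ⟨g₂, hg₂, e₂⟩
    have hF : SAGraph S fun x => fun b : Bool => bif b then g₁ x else g₂ x :=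
      SAFun.pi hS (by rintro (_ | _) <;> assumption)
    refine ⟨_, hF.eval_poly (X true * X false), fun a => ?_⟩
    simp [e₁, e₂]
  add_mem' := by
    rintro h₁ h₂ ⟨g₁, hg₁, e₁⟩ ⟨g₂, hg₂, e₂⟩
    have hF : SAGraph S fun x => fun b : Bool => bif b then g₁ x else g₂ x :=
      SAFun.pi hS (by rintro (_ | _) <;> assumption)
    refine ⟨_, hF.eval_poly (X true + X false), fun a => ?_⟩
    simp [e₁, e₂]
  algebraMap_mem' r := by
    have hF : SAGraph S fun _ => fun b : Empty => b.elim := SAFun.pi hS (by rintro ⟨⟩)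
    refine ⟨_, hF.eval_poly (C r), fun a => ?_⟩
    simp

end SemialgebraicMaps

section LocalConstancy
open MvPolynomial

lemma sign_eventually_eq {X : Type*} [TopologicalSpace X] {f : X → ℝ} {x : X}
    (hf : ContinuousAt f x) (h : f x ≠ 0) :
    ∀ᶠ y in nhds x, SignType.sign (f y) = SignType.sign (f x) := by
  rcases lt_or_gt_of_ne h with h | h
  · filter_upwards [hf.eventually_lt continuousAt_const h] with y hy
    rw [sign_neg h, sign_neg hy]
  · filter_upwards [continuousAt_const.eventually_lt hf h] with y hy
    rw [sign_pos h, sign_pos hy]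

lemma Polynomial.eventually_sign_eq (T : Finset (Polynomial ℝ)) {y : ℝ}
    (hy : ∀ t ∈ T, t ≠ 0 → t.eval y ≠ 0) :
    ∀ᶠ y' in nhds y, ∀ t ∈ T, SignType.sign (t.eval y') = SignType.sign (t.eval y) := by
  rw [Filter.eventually_all_finset]
  intro t ht
  by_cases h0 : t = 0
  · simp [h0]
  · exact sign_eventually_eq t.continuous.continuousAt (hy t ht h0)

lemma exists_open_sign_const {ι : Type*} [Finite ι] (T : Finset (MvPolynomial ι ℝ))
    {S : Set (ι → ℝ)} (hS : S.Nonempty) : ∃ U : Set (ι → ℝ), IsOpen U ∧ (U ∩ S).Nonempty ∧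
      ∀ x ∈ U ∩ S, ∀ y ∈ U ∩ S, ∀ t ∈ T, SignType.sign (eval x t) = SignType.sign (eval y t) := by
  classical
  induction T using Finset.induction_on with
  | empty => exact ⟨univ, isOpen_univ, by simpa using hS, by simp⟩
  | insert t T _ ih =>
    obtain ⟨U, hU, hne, h⟩ := ih
    by_cases hz : ∃ x ∈ U ∩ S, eval x t ≠ 0
    · obtain ⟨x, hx, hxt⟩ := hz
      have hev := sign_eventually_eq (f := fun x => eval x t) t.continuous_eval.continuousAt hxt
      obtain ⟨V, hV, hVo, hxV⟩ := mem_nhds_iff.1 hev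
      refine ⟨U ∩ V, hU.inter hVo, ⟨x, ⟨hx.1, hxV⟩, hx.2⟩, ?_⟩
      intro a ha b hb s hs
      rcases Finset.mem_insert.1 hs with rfl | hs
      · exact (hV ha.1.2).trans (hV hb.1.2).symm
      · exact h a ⟨ha.1.1, ha.2⟩ b ⟨hb.1.1, hb.2⟩ s hs
    · push Not at hz
      refine ⟨U, hU, hne, fun a ha b hb s hs => ?_⟩
      rcases Finset.mem_insert.1 hs with rfl | hs
      · rw [hz a ha, hz b hb]
      · exact h a ha b hb s hs

lemma SA.exists_open_const {ι κ : Type*} [Finite ι] [Finite κ] {P : κ → (ι → ℝ) → Prop}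
    (hP : ∀ k, SA (P k)) {S : Set (ι → ℝ)} (hS : S.Nonempty) :
    ∃ U : Set (ι → ℝ), IsOpen U ∧ (U ∩ S).Nonempty ∧
      ∀ x ∈ U ∩ S, ∀ y ∈ U ∩ S, ∀ k, P k x ↔ P k y := by
  classical
  cases nonempty_fintype κ
  choose T hT using hP
  obtain ⟨U, hU, hne, h⟩ := exists_open_sign_const (Finset.univ.biUnion T) hS
  exact ⟨U, hU, hne, fun x hx y hy k => hT k x y fun t ht =>
    h x hx y hy t (Finset.mem_biUnion.2 ⟨k, Finset.mem_univ _, ht⟩)⟩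

lemma SA.finite_real_of_countable {P : (Unit → ℝ) → Prop} (hP : SA P)
    (hc : {y : ℝ | P fun _ => y}.Countable) : {y : ℝ | P fun _ => y}.Finite := by
  classical
  obtain ⟨T, hT⟩ := hP
  let q : MvPolynomial Unit ℝ → Polynomial ℝ := aeval fun _ => Polynomial.X
  have hq : ∀ (t : MvPolynomial Unit ℝ) (y : ℝ), (q t).eval y = eval (fun _ => y) t := by
    intro t y
    have : ((Polynomial.aeval y : Polynomial ℝ →ₐ[ℝ] ℝ).comp
        (aeval fun _ => Polynomial.X)) = (aeval fun _ => y : MvPolynomial Unit ℝ →ₐ[ℝ] ℝ) := by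
      ext; simp
    have h := DFunLike.congr_fun this t
    simpa [q, Polynomial.coe_aeval_eq_eval, aeval_eq_eval] using h
  have hfin : (⋃ t ∈ (T.image q).filter (· ≠ 0), {y : ℝ | t.IsRoot y}).Finite := by
    refine (Finset.finite_toSet _).biUnion fun t ht => Polynomial.finite_setOfPred_isRoot ?_
    exact (Finset.mem_filter.1 ht).2
  refine hfin.subset fun y hy => ?_
  by_contra hroot
  have hev := Polynomial.eventually_sign_eq (T.image q) (y := y) (fun t ht h0 hr =>
    hroot (mem_biUnion (Finset.mem_filter.2 ⟨ht, h0⟩) hr))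
  obtain ⟨z, hzc, hz⟩ := (hc.dense_compl ℝ).inter_nhds_nonempty hev
  refine hzc ((hT _ _ fun t ht => ?_).2 hy)
  rw [← hq, ← hq]
  exact hz _ (Finset.mem_image_of_mem _ ht)

lemma SA.finite_of_countable {κ : Type} [Finite κ] {S : Set (κ → ℝ)} (hS : SA fun x => x ∈ S)
    (hc : S.Countable) : S.Finite := by
  have h : ∀ k, ((fun x : κ → ℝ => x k) '' S).Finite := by
    intro k
    have hgr := (SAGraph.of_poly hS fun _ : Unit => X k).image
    refine (hgr.finite_real_of_countable ?_).subset ?_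
    · refine (hc.image fun x => x k).mono ?_
      rintro y ⟨x, hx, hxy⟩
      exact ⟨x, hx, by simpa using congrFun hxy ()⟩
    · rintro _ ⟨x, hx, rfl⟩
      exact ⟨x, hx, by simp⟩
  exact (Finite.pi h).subset fun x hx k _ => ⟨x, hx, rfl⟩

end LocalConstancy

section GenericAnalyticity
open MvPolynomial

/-- The function of `(x, y)` defined by a polynomial in `y` with polynomial coefficients in `x`. -/
noncomputable def evalPair {ι : Type*} (F : Polynomial (MvPolynomial ι ℝ)) (u : (ι → ℝ) × ℝ) : ℝ :=
  (F.map (eval u.1)).eval u.2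

lemma evalPair_eq {ι : Type*} (F : Polynomial (MvPolynomial ι ℝ)) (u : (ι → ℝ) × ℝ) :
    evalPair F u = eval (fun o => o.elim u.2 u.1) ((optionEquivLeft ℝ ι).symm F) := by
  rw [← eval_map_optionEquivLeft, AlgEquiv.apply_symm_apply]; rfl

lemma sa_evalPair {ι : Type*} (F : Polynomial (MvPolynomial ι ℝ)) :
    SA fun z : Option ι → ℝ => evalPair F (fun i => z (some i), z none) = 0 :=
  (SA.eval_eq_zero ((optionEquivLeft ℝ ι).symm F)).congr fun z => by
    rw [evalPair_eq]
    have : z = (fun o => o.elim (z none) fun i => z (some i)) := by ext (_ | i) <;> rfl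
    rw [← this]

lemma sa_map_eval_eq_zero {ι : Type*} (F : Polynomial (MvPolynomial ι ℝ)) :
    SA fun x : ι → ℝ => F.map (eval x) = 0 :=
  (SA.forall_finite (κ := Fin (F.natDegree + 1)) fun k => SA.eval_eq_zero (F.coeff k)).congr
    fun x => by
      constructor
      · intro h
        ext k
        rw [Polynomial.coeff_map, Polynomial.coeff_zero]
        by_cases hk : k < F.natDegree + 1
        · exact h ⟨k, hk⟩
        · rw [Polynomial.coeff_eq_zero_of_natDegree_lt (by omega), map_zero]
      · intro h k
        rw [← Polynomial.coeff_map, h, Polynomial.coeff_zero]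

variable {n : ℕ}

lemma analyticAt_evalPair (F : Polynomial (MvPolynomial (Fin n) ℝ)) (u : (Fin n → ℝ) × ℝ) :
    AnalyticAt ℝ (evalPair F) u := by
  have h : evalPair F = fun u : (Fin n → ℝ) × ℝ =>
      aeval (fun o : Option (Fin n) => o.elim u.2 u.1) ((optionEquivLeft ℝ (Fin n)).symm F) := by
    ext u
    rw [evalPair_eq, aeval_eq_eval]
  rw [h]
  refine AnalyticAt.aeval_mvPolynomial (fun o => ?_) _
  cases o with
  | none => exact analyticAt_snd
  | some i => exact ((ContinuousLinearMap.proj (R := ℝ) (φ := fun _ : Fin n => ℝ) i).comp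
      (ContinuousLinearMap.fst ℝ (Fin n → ℝ) ℝ)).analyticAt u

lemma exists_analytic_branch (F : Polynomial (MvPolynomial (Fin n) ℝ)) {x : Fin n → ℝ} {y : ℝ}
    (h0 : evalPair F (x, y) = 0) (h1 : evalPair F.derivative (x, y) ≠ 0) :
    ∃ h : (Fin n → ℝ) → ℝ, AnalyticAt ℝ h x ∧ h x = y ∧
      ∀ᶠ x' in nhds x, evalPair F (x', h x') = 0 ∧ evalPair F.derivative (x', h x') ≠ 0 := by
  have cdf : ContDiffAt ℝ ⊤ (evalPair F) (x, y) := (analyticAt_evalPair F _).contDiffAt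
  have hd : HasDerivAt (fun t => evalPair F (x, t)) (evalPair F.derivative (x, y)) y := by
    have := (F.map (eval x)).hasDerivAt y
    rwa [Polynomial.derivative_map] at this
  have hf : HasFDerivAt (fun t => evalPair F (x, t))
      (fderiv ℝ (evalPair F) (x, y) ∘L .inr ℝ (Fin n → ℝ) ℝ) y :=
    (cdf.differentiableAt (by simp)).hasFDerivAt.comp y (hasFDerivAt_prodMk_right x y)
  have heq := hf.unique hd.hasFDerivAt
  have hinv : (fderiv ℝ (evalPair F) (x, y) ∘L .inr ℝ (Fin n → ℝ) ℝ).IsInvertible := by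
    refine ⟨ContinuousLinearEquiv.unitsEquivAut ℝ (Units.mk0 _ h1), ?_⟩
    rw [heq]
    ext
    simp
  have hne : (⊤ : WithTop ℕ∞) ≠ 0 := by simp
  have han := (cdf.contDiffAt_implicitFunction hne hinv).analyticAt
  have hself := cdf.implicitFunction_apply_self hne hinv
  refine ⟨cdf.implicitFunction hne hinv, han, hself, ?_⟩
  have hcont : ContinuousAt (fun x' => evalPair F.derivative (x', cdf.implicitFunction hne hinv x')) x := by
    refine ContinuousAt.comp (g := evalPair F.derivative) (f := fun x' => (x', cdf.implicitFunction hne hinv x'))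
      (analyticAt_evalPair F.derivative _).continuousAt
      (continuousAt_id.prodMk han.continuousAt)
  have hev := hcont.eventually_ne (y := 0) (by
    have hs : cdf.implicitFunction hne hinv x = y := hself
    rwa [hs])
  filter_upwards [cdf.eventually_apply_implicitFunction hne hinv, hev] with x' h2 h3
  exact ⟨h2.trans h0, h3⟩

/-- Near suitable points, a semialgebraic function is a simple root of a polynomial. -/
lemma SAFun.exists_simple_root {D S : Set (Fin n → ℝ)} {ρ : (Fin n → ℝ) → ℝ} (hρ : SAFun D ρ)
    (hSD : S ⊆ D) (hS : S.Nonempty) : ∃ U : Set (Fin n → ℝ), IsOpen U ∧ (U ∩ S).Nonempty ∧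
      ∃ F : Polynomial (MvPolynomial (Fin n) ℝ), ∀ x ∈ U ∩ S,
        evalPair F (x, ρ x) = 0 ∧ evalPair F.derivative (x, ρ x) ≠ 0 := by
  classical
  obtain ⟨T, hT⟩ := id hρ
  have hroot : ∀ x ∈ S, ∃ t ∈ T, (optionEquivLeft ℝ (Fin n) t).map (eval x) ≠ 0 ∧
      evalPair (optionEquivLeft ℝ (Fin n) t) (x, ρ x) = 0 := by
    intro x hx
    by_contra! hc
    have hev := Polynomial.eventually_sign_eq
      (T.image fun t => (optionEquivLeft ℝ (Fin n) t).map (eval x)) (y := ρ x) (by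
        intro p hp
        obtain ⟨t, ht, rfl⟩ := Finset.mem_image.1 hp
        exact hc t ht)
    obtain ⟨y, hy, hne⟩ := ((hev.filter_mono nhdsWithin_le_nhds).and
      (self_mem_nhdsWithin (s := {ρ x}ᶜ))).exists
    have := (hT (fun o => o.elim y x) (fun o => o.elim (ρ x) x) fun t ht => by
      rw [← eval_map_optionEquivLeft, ← eval_map_optionEquivLeft]
      exact hy _ (Finset.mem_image_of_mem _ ht)).2 ⟨hSD hx, rfl⟩
    exact hne this.2.symm
  let N : ℕ := T.sup fun t => (optionEquivLeft ℝ (Fin n) t).natDegree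
  have hder : ∀ (t : T) (k : Fin (N + 1)), SA fun x => x ∈ D ∧
      evalPair (Polynomial.derivative^[k] (optionEquivLeft ℝ (Fin n) t.1)) (x, ρ x) = 0 :=
    fun t k => hρ.exists_and (Q := fun x y =>
      evalPair (Polynomial.derivative^[k] (optionEquivLeft ℝ (Fin n) t.1)) (x, y) = 0) (sa_evalPair _)
  obtain ⟨U, hU, ⟨x₁, hx₁⟩, hconst⟩ := SA.exists_open_const
    (P := fun (i : T ⊕ T × Fin (N + 1)) x => i.elim
      (fun t => (optionEquivLeft ℝ (Fin n) t.1).map (eval x) = 0)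
      (fun u => x ∈ D ∧
        evalPair (Polynomial.derivative^[u.2] (optionEquivLeft ℝ (Fin n) u.1.1)) (x, ρ x) = 0))
    (by rintro (t | ⟨t, k⟩)
        · exact sa_map_eval_eq_zero _
        · exact hder t k) hS
  refine ⟨U, hU, ⟨x₁, hx₁⟩, ?_⟩
  obtain ⟨t, ht, ht0, htr⟩ := hroot x₁ hx₁.2
  set F := optionEquivLeft ℝ (Fin n) t with hF
  have hconst' : ∀ k ≤ N, ∀ x ∈ U ∩ S, evalPair (Polynomial.derivative^[k] F) (x, ρ x) = 0 ↔
      evalPair (Polynomial.derivative^[k] F) (x₁, ρ x₁) = 0 := by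
    intro k hk x hx
    have := hconst x hx x₁ hx₁ (Sum.inr (⟨t, ht⟩, ⟨k, by omega⟩))
    simpa [hSD hx.2, hSD hx₁.2] using this
  have hex : ∃ k, evalPair (Polynomial.derivative^[k] F) (x₁, ρ x₁) ≠ 0 ∧ k ≤ N := by
    by_contra! hc
    have hroots : ∀ m ≤ N, (Polynomial.derivative^[m] (F.map (eval x₁))).IsRoot (ρ x₁) := by
      intro m hm
      by_contra hne
      refine absurd hm (not_le.2 (hc m ?_))
      rw [Polynomial.iterate_derivative_map] at hne
      exact hne
    have h1 := (Polynomial.lt_rootMultiplicity_iff_isRoot_iterate_derivative ht0).2 hroots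
    have h2 : F.natDegree ≤ N :=
      Finset.le_sup (f := fun t => (optionEquivLeft ℝ (Fin n) t).natDegree) ht
    have h3 : (F.map (eval x₁)).rootMultiplicity (ρ x₁) ≤ (F.map (eval x₁)).natDegree := by
      rw [← Polynomial.count_roots]
      exact (Multiset.count_le_card _ _).trans (Polynomial.card_roots' _)
    have h4 : (F.map (eval x₁)).natDegree ≤ F.natDegree := Polynomial.natDegree_map_le
    omega
  obtain ⟨hk, hkN⟩ := Nat.find_spec hex
  have hmin := fun m (hm : m < Nat.find hex) => Nat.find_min hex hm
  set k := Nat.find hex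
  have hk0 : k ≠ 0 := by
    intro h0
    rw [h0] at hk
    exact hk htr
  obtain ⟨m, hm⟩ := Nat.exists_eq_succ_of_ne_zero hk0
  refine ⟨Polynomial.derivative^[m] F, fun x hx => ⟨?_, ?_⟩⟩
  · rw [hconst' m (by omega) x hx]
    have := hmin m (by omega)
    push Not at this
    by_contra hc
    exact absurd (this hc) (by omega)
  · rw [← Function.iterate_succ_apply' (f := fun p : Polynomial (MvPolynomial (Fin n) ℝ) => p.derivative)]
    rw [hm] at hk hkN
    exact fun h => hk ((hconst' _ hkN x hx).1 h)

/-- The simple real roots of `F` over `x`. -/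
def simpleRoots (F : Polynomial (MvPolynomial (Fin n) ℝ)) (x : Fin n → ℝ) : Set ℝ :=
  {y | evalPair F (x, y) = 0 ∧ evalPair F.derivative (x, y) ≠ 0}

lemma simpleRoots_finite (F : Polynomial (MvPolynomial (Fin n) ℝ)) (x : Fin n → ℝ) :
    (simpleRoots F x).Finite ∧ (simpleRoots F x).ncard ≤ F.natDegree := by
  classical
  by_cases h : F.map (eval x) = 0
  · have : simpleRoots F x = ∅ := by
      ext y
      simp only [simpleRoots, mem_ofPred_eq, mem_empty_iff_false, iff_false, not_and, not_not,
        evalPair]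
      intro _
      rw [← Polynomial.derivative_map, h]
      simp
    rw [this]
    simp
  · have hsub : simpleRoots F x ⊆ ((F.map (eval x)).roots.toFinset : Set ℝ) := by
      intro y hy
      simpa [h] using show (F.map (eval x)).eval y = 0 from hy.1
    refine ⟨(Finset.finite_toSet _).subset hsub, (ncard_le_ncard hsub (Finset.finite_toSet _)).trans ?_⟩
    rw [ncard_coe_finset]
    exact (Multiset.toFinset_card_le _).trans ((Polynomial.card_roots' _).trans Polynomial.natDegree_map_le)

/-- A semialgebraic function is analytic on some nonempty relatively open piece. -/
lemma SAFun.exists_analytic {D S : Set (Fin n → ℝ)} {ρ : (Fin n → ℝ) → ℝ} (hρ : SAFun D ρ)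
    (hSD : S ⊆ D) (hS : S.Nonempty) : ∃ U : Set (Fin n → ℝ), IsOpen U ∧ (U ∩ S).Nonempty ∧
      ∃ h : (Fin n → ℝ) → ℝ, AnalyticOnNhd ℝ h U ∧ ∀ x ∈ U ∩ S, h x = ρ x := by
  classical
  obtain ⟨U, hU, hne, F, hF⟩ := hρ.exists_simple_root hSD hS
  set S' := U ∩ S
  obtain ⟨x₀, hx₀, hmax⟩ : ∃ x₀ ∈ S', ∀ x ∈ S',
      (simpleRoots F x).ncard ≤ (simpleRoots F x₀).ncard := by
    have hfin : ((fun x => (simpleRoots F x).ncard) '' S').Finite :=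
      (finite_Iic F.natDegree).subset (by
        rintro _ ⟨x, -, rfl⟩; exact (simpleRoots_finite F x).2)
    obtain ⟨_, ⟨x₀, hx₀, rfl⟩, h⟩ := hfin.exists_maximal (hne.image _)
    refine ⟨x₀, hx₀, fun x hx => ?_⟩
    by_contra! hc
    exact absurd (h ⟨x, hx, rfl⟩ hc.le) (not_le.2 hc)
  have hfin₀ := (simpleRoots_finite F x₀).1
  choose! h han hself hev using fun y (hy : y ∈ simpleRoots F x₀) =>
    exists_analytic_branch F hy.1 hy.2
  have hW : ∀ᶠ x in nhds x₀, x ∈ U ∧ (∀ y ∈ simpleRoots F x₀, h y x ∈ simpleRoots F x ∧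
      AnalyticAt ℝ (h y) x ∧ ∀ z ∈ simpleRoots F x₀, z ≠ y → (h y x - y) ^ 2 < (h y x - z) ^ 2) := by
    refine (hU.eventually_mem hx₀.1).and ?_
    rw [Filter.eventually_all_finite hfin₀]
    intro y hy
    refine (hev y hy).and ((han y hy).eventually_analyticAt.and ?_)
    rw [Filter.eventually_all_finite hfin₀]
    intro z hz
    by_cases hzy : z = y
    · exact Filter.Eventually.of_forall fun _ h => absurd hzy h
    have hc := (han y hy).continuousAt
    have : ∀ᶠ x in nhds x₀, (h y x - y) ^ 2 < (h y x - z) ^ 2 := by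
      refine ((hc.sub continuousAt_const).pow 2).eventually_lt ((hc.sub continuousAt_const).pow 2) ?_
      have : 0 < (y - z) ^ 2 := by
        have := sub_ne_zero.2 (Ne.symm hzy)
        positivity
      simpa [hself y hy] using this
    filter_upwards [this] with x hx _ using hx
  obtain ⟨W, hWsub, hWo, hx₀W⟩ := mem_nhds_iff.1 hW
  have hmem : ∀ x ∈ W ∩ S', ∃ y ∈ simpleRoots F x₀, h y x = ρ x := by
    intro x hx
    have hx' := (hWsub hx.1).2
    have hsub : (fun y => h y x) '' simpleRoots F x₀ ⊆ simpleRoots F x := by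
      rintro _ ⟨y, hy, rfl⟩; exact (hx' y hy).1
    have hinj : InjOn (fun y => h y x) (simpleRoots F x₀) := by
      intro y hy z hz hyz
      by_contra hne'
      have h1 := (hx' y hy).2.2 z hz (Ne.symm hne')
      have h2 := (hx' z hz).2.2 y hy hne'
      simp only at hyz
      rw [hyz] at h1
      exact lt_asymm h1 h2
    have heq : (fun y => h y x) '' simpleRoots F x₀ = simpleRoots F x := by
      refine eq_of_subset_of_ncard_le hsub ?_ (simpleRoots_finite F x).1
      rw [hinj.ncard_image]
      exact hmax x hx.2
    have : ρ x ∈ simpleRoots F x := hF x hx.2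
    rw [← heq] at this
    exact this
  have : Finite (simpleRoots F x₀) := hfin₀
  have hclose : ∀ y z : simpleRoots F x₀, SA fun x => x ∈ D ∧ (ρ x - y) ^ 2 ≤ (ρ x - z) ^ 2 := by
    intro y z
    refine hρ.exists_and (Q := fun _ t => (t - y.1) ^ 2 ≤ (t - z.1) ^ 2) ?_
    refine ((SA.eval_lt ((X none - C z.1) ^ 2) ((X none - C y.1) ^ 2)).not).congr fun x => ?_
    simp
  obtain ⟨V, hV, ⟨x₁, hx₁⟩, hconst⟩ := SA.exists_open_const
    (fun u : simpleRoots F x₀ × simpleRoots F x₀ => hclose u.1 u.2) (S := W ∩ S')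
    ⟨x₀, hx₀W, hx₀⟩
  obtain ⟨y, hy, hyx⟩ := hmem x₁ hx₁.2
  have hS'D : ∀ x ∈ S', x ∈ D := fun x hx => hSD hx.2
  refine ⟨V ∩ W ∩ U, (hV.inter hWo).inter hU, ⟨x₁, ⟨⟨hx₁.1, hx₁.2.1⟩, hx₁.2.2.1⟩, hx₁.2.2.2⟩, h y,
    fun x hx => ((hWsub hx.1.2).2 y hy).2.1, ?_⟩
  rintro x ⟨⟨⟨hxV, hxW⟩, hxU⟩, hxS⟩
  have hx : x ∈ W ∩ S' := ⟨hxW, hxU, hxS⟩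
  obtain ⟨z, hz, hzx⟩ := hmem x hx
  by_contra hne'
  have hzy : z ≠ y := by rintro rfl; exact hne' hzx
  have h1 := (hconst x₁ hx₁ x ⟨hxV, hx⟩ (⟨y, hy⟩, ⟨z, hz⟩)).1
    ⟨hS'D _ hx₁.2.2, by
      rw [← hyx]
      exact (((hWsub hx₁.2.1).2 y hy).2.2 z hz hzy).le⟩
  have h2 := ((hWsub hxW).2 z hz).2.2 y hy hzy.symm
  rw [hzx] at h2
  exact absurd h1.2 (not_le.2 h2)

lemma SAGraph.exists_analytic {D : Set (Fin n → ℝ)} {m : ℕ} {F : (Fin n → ℝ) → Fin m → ℝ}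
    (hF : SAGraph D F) {S : Set (Fin n → ℝ)} (hSD : S ⊆ D) (hS : S.Nonempty) :
    ∃ U : Set (Fin n → ℝ), IsOpen U ∧ (U ∩ S).Nonempty ∧
      ∃ h : (Fin n → ℝ) → Fin m → ℝ, AnalyticOnNhd ℝ h U ∧ ∀ x ∈ U ∩ S, h x = F x := by
  classical
  have key : ∀ s : Finset (Fin m), ∃ U : Set (Fin n → ℝ), IsOpen U ∧ (U ∩ S).Nonempty ∧
      ∀ k ∈ s, ∃ h : (Fin n → ℝ) → ℝ, AnalyticOnNhd ℝ h U ∧ ∀ x ∈ U ∩ S, h x = F x k := by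
    intro s
    induction s using Finset.induction_on with
    | empty => exact ⟨univ, isOpen_univ, by simpa using hS, by simp⟩
    | insert k s _ ih =>
      obtain ⟨U, hU, hne, h⟩ := ih
      obtain ⟨V, hV, ⟨x, hx⟩, g, hg, hgF⟩ := (hF.component k).exists_analytic
        (inter_subset_right.trans hSD) hne
      refine ⟨V ∩ U, hV.inter hU, ⟨x, ⟨hx.1, hx.2.1⟩, hx.2.2⟩, fun j hj => ?_⟩
      rcases Finset.mem_insert.1 hj with rfl | hj
      · exact ⟨g, hg.mono inter_subset_left, fun x hx => hgF x ⟨hx.1.1, hx.1.2, hx.2⟩⟩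
      · obtain ⟨g', hg', hgF'⟩ := h j hj
        exact ⟨g', hg'.mono inter_subset_right, fun x hx => hgF' x ⟨hx.1.2, hx.2⟩⟩
  obtain ⟨U, hU, hne, h⟩ := key Finset.univ
  choose g hg hgF using fun k => h k (Finset.mem_univ k)
  refine ⟨U, hU, hne, fun x k => g k x, ?_, fun x hx => funext fun k => hgF k x hx⟩
  exact AnalyticOnNhd.pi hg

end GenericAnalyticity

section ChevalleyRepresentation

variable {A : Type*} (𝒜 : Subalgebra ℝ (A → ℝ))

lemma linearFunctional_mem_of_entries {β : Type*} [Fintype β] [DecidableEq β]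
    (φ : Matrix β β ℝ →ₗ[ℝ] ℝ) {F : A → Matrix β β ℝ} (hF : ∀ i j, (fun a => F a i j) ∈ 𝒜) :
    (fun a => φ (F a)) ∈ 𝒜 := by
  have h : (fun a => φ (F a)) = ∑ i, ∑ j, φ (Matrix.single i j 1) • fun a => F a i j := by
    ext a
    conv_lhs => rw [Matrix.matrix_eq_sum_single (F a)]
    simp only [map_sum, Finset.sum_apply, Pi.smul_apply, smul_eq_mul]
    refine Finset.sum_congr rfl fun i _ => Finset.sum_congr rfl fun j _ => ?_
    rw [show Matrix.single i j (F a i j) = F a i j • Matrix.single i j (1 : ℝ) by simp, map_smul,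
      smul_eq_mul, mul_comm]
  rw [h]
  exact sum_mem fun i _ => sum_mem fun j _ => 𝒜.smul_mem (hF i j) _

lemma mul_entry_mem {β : Type*} [Fintype β] {F K : A → Matrix β β ℝ}
    (hF : ∀ i j, (fun a => F a i j) ∈ 𝒜) (hK : ∀ i j, (fun a => K a i j) ∈ 𝒜) (i j : β) :
    (fun a => (F a * K a) i j) ∈ 𝒜 := by
  have h : (fun a => (F a * K a) i j) = ∑ l, (fun a => F a i l) * fun a => K a l j := by
    ext a; simp [Matrix.mul_apply]
  rw [h]
  exact sum_mem fun l _ => mul_mem (hF i l) (hK l j)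

variable [Group A] (N : Subgroup A)

/-- Matrices commuting with the image of `N`. -/
def commutant {β : Type*} [Fintype β] [DecidableEq β] (P : A →* Matrix β β ℝ) :
    Submodule ℝ (Matrix β β ℝ) where
  carrier := {T | ∀ n ∈ N, P n * T = T * P n}
  add_mem' hS hT n hn := by rw [mul_add, add_mul, hS n hn, hT n hn]
  zero_mem' n _ := by simp
  smul_mem' c T hT n hn := by rw [mul_smul_comm, smul_mul_assoc, hT n hn]

/-- Conjugation on the commutant of a normal subgroup. -/
def conjCommutant [hN : N.Normal] {β : Type*} [Fintype β] [DecidableEq β]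
    (P : A →* Matrix β β ℝ) (a : A) : commutant N P →ₗ[ℝ] commutant N P :=
  (((LinearMap.mulLeft ℝ (P a)).comp (LinearMap.mulRight ℝ (P a⁻¹))).restrict (fun T hT n hn => by
    have h := hT (a⁻¹ * n * a) (by simpa using hN.conj_mem n hn a⁻¹)
    have h1 : P n * P a = P a * P (a⁻¹ * n * a) := by
      rw [← map_mul, ← map_mul]; congr 1; group
    have h2 : P (a⁻¹ * n * a) * P a⁻¹ = P a⁻¹ * P n := by
      rw [← map_mul, ← map_mul]; congr 1; group
    simp only [LinearMap.comp_apply, LinearMap.mulLeft_apply, LinearMap.mulRight_apply]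
    calc P n * (P a * (T * P a⁻¹)) = (P n * P a) * T * P a⁻¹ := by simp only [mul_assoc]
      _ = P a * (P (a⁻¹ * n * a) * T) * P a⁻¹ := by rw [h1]; simp only [mul_assoc]
      _ = P a * T * (P (a⁻¹ * n * a) * P a⁻¹) := by rw [h]; simp only [mul_assoc]
      _ = P a * (T * P a⁻¹) * P n := by rw [h2]; simp only [mul_assoc]))

lemma conjCommutant_apply [N.Normal] {β : Type*} [Fintype β] [DecidableEq β]
    (P : A →* Matrix β β ℝ) (a : A) (T : commutant N P) :
    (conjCommutant N P a T : Matrix β β ℝ) = P a * (T.1 * P a⁻¹) := rfl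

/-- A representation in which `N` acts diagonally yields one that is trivial on `N`, whose kernel
acts by elements commuting with the diagonal projections. -/
lemma exists_representation_of_diagonal [N.Normal] (hinv : ∀ h ∈ 𝒜, (fun a => h a⁻¹) ∈ 𝒜)
    {β : Type*} [Fintype β] [DecidableEq β] (P : A →* Matrix β β ℝ)
    (hP : ∀ i j, (fun a => P a i j) ∈ 𝒜) (hdiag : ∀ n ∈ N, ∀ i j, i ≠ j → P n i j = 0) :
    ∃ (r : ℕ) (ρ : A →* Matrix (Fin r) (Fin r) ℝ), (∀ i j, (fun a => ρ a i j) ∈ 𝒜) ∧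
      (∀ n ∈ N, ρ n = 1) ∧ ∀ a, ρ a = 1 → ∀ i j, i ≠ j → P a i j = 0 := by
  let b := Module.finBasis ℝ (commutant N P)
  let conj : A →* Module.End ℝ (commutant N P) :=
    { toFun := conjCommutant N P
      map_one' := by
        ext1 T
        apply Subtype.ext
        simp [conjCommutant_apply]
      map_mul' := fun x y => by
        ext1 T
        apply Subtype.ext
        simp [conjCommutant_apply, mul_assoc] }
  let ρ : A →* Matrix _ _ ℝ :=
    (LinearMap.toMatrixAlgEquiv b).toAlgHom.toRingHom.toMonoidHom.comp conj
  have hρ : ∀ a, ρ a = LinearMap.toMatrixAlgEquiv b (conj a) := fun a => rfl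
  refine ⟨_, ρ, fun i j => ?_, fun n hn => ?_, fun a ha i j hij => ?_⟩
  · obtain ⟨φ, hφ⟩ := (b.coord i).exists_extend
    have : (fun a => ρ a i j) = fun a => φ (P a * ((b j).1 * P a⁻¹)) := by
      ext a
      rw [hρ, LinearMap.toMatrixAlgEquiv_apply, ← conjCommutant_apply, ← Module.Basis.coord_apply, ← hφ]
      rfl
    rw [this]
    refine linearFunctional_mem_of_entries 𝒜 φ fun i j => mul_entry_mem 𝒜 hP (fun i j => ?_) i j
    refine mul_entry_mem 𝒜 (F := fun _ => (b _).1) (fun i j => ?_) (fun i j => ?_) i j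
    · exact 𝒜.algebraMap_mem _
    · exact hinv _ (hP i j)
  · rw [hρ]
    have : conj n = 1 := by
      ext1 T
      apply Subtype.ext
      change P n * (T.1 * P n⁻¹) = T.1
      rw [← mul_assoc, T.2 n hn, mul_assoc, ← map_mul]
      simp
    rw [this, map_one]
  · have hconj : conj a = 1 := by
      apply (LinearMap.toMatrixAlgEquiv b).injective
      rw [← hρ, ha, map_one]
    have hmem : Matrix.single j j (1 : ℝ) ∈ commutant N P := by
      intro n hn
      have hn' : P n = Matrix.diagonal fun i => P n i i := by
        ext p q
        by_cases hpq : p = q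
        · subst hpq; simp
        · rw [Matrix.diagonal_apply_ne _ hpq, hdiag n hn p q hpq]
      rw [hn', show Matrix.single j j (1 : ℝ) = Matrix.diagonal (Pi.single j 1) by
        rw [Matrix.diagonal_single], Matrix.diagonal_mul_diagonal, Matrix.diagonal_mul_diagonal]
      congr 1; ext i; ring
    have h : P a * (Matrix.single j j (1 : ℝ) * P a⁻¹) = Matrix.single j j 1 :=
      congrArg Subtype.val (LinearMap.congr_fun hconj ⟨_, hmem⟩)
    have h' : P a * Matrix.single j j (1 : ℝ) = Matrix.single j j 1 * P a := by
      conv_rhs => rw [← h]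
      rw [mul_assoc, mul_assoc, ← map_mul]
      simp
    have := congrFun (congrFun h' i) j
    simpa [hij] using this

end ChevalleyRepresentation

section Eigenline

variable {A : Type*} (𝒜 : Subalgebra ℝ (A → ℝ))

/-- Coefficients of a finite-dimensional representation on functions belong to `𝒜` as soon as
the orbit maps followed by evaluations do. -/
lemma dual_orbit_mem {X : Type*} {E : Submodule ℝ (X → ℝ)} [FiniteDimensional ℝ E]
    (R : A → E →ₗ[ℝ] E) (h : ∀ e x, (fun a => (R a e : X → ℝ) x) ∈ 𝒜) (φ : Module.Dual ℝ E) (e : E) :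
    (fun a => φ (R a e)) ∈ 𝒜 := by
  let Λ : Submodule ℝ (Module.Dual ℝ E) :=
    { carrier := {φ | ∀ e, (fun a => φ (R a e)) ∈ 𝒜}
      add_mem' := fun hφ hψ e => 𝒜.add_mem (hφ e) (hψ e)
      zero_mem' := fun e => 𝒜.zero_mem
      smul_mem' := fun c φ hφ e => 𝒜.smul_mem (hφ e) c }
  have hbot : Λ.dualCoannihilator = ⊥ := by
    rw [eq_bot_iff]
    intro e he
    rw [Submodule.mem_dualCoannihilator] at he
    rw [Submodule.mem_bot]
    ext x
    exact he ((LinearMap.proj x).comp E.subtype) fun e => h e x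
  have htop : Λ = ⊤ := by
    rw [← Subspace.dualCoannihilator_dualAnnihilator_eq (W := Λ), hbot]
    simp
  have : φ ∈ Λ := htop ▸ Submodule.mem_top
  exact this e

variable [Group A] (N : Subgroup A)

/-- Chevalley: if `N` stabilizes the line spanned by `D`, some representation trivial on `N`
has its kernel inside the stabilizer of that line. -/
lemma exists_representation_of_eigenvector [N.Normal] (hinv : ∀ h ∈ 𝒜, (fun a => h a⁻¹) ∈ 𝒜)
    {X : Type*} (T : A →* Module.End ℝ (X → ℝ)) {V : Submodule ℝ (X → ℝ)} (hV : V.FG)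
    (hstab : ∀ a, ∀ e ∈ V, T a e ∈ V) (h𝒜 : ∀ e ∈ V, ∀ x, (fun a => T a e x) ∈ 𝒜)
    {D : X → ℝ} (hDV : D ∈ V) (hD : D ≠ 0) (hN : ∀ n ∈ N, ∃ c : ℝ, T n D = c • D) :
    ∃ (r : ℕ) (ρ : A →* Matrix (Fin r) (Fin r) ℝ), (∀ i j, (fun a => ρ a i j) ∈ 𝒜) ∧
      (∀ n ∈ N, ρ n = 1) ∧ ∀ a, ρ a = 1 → ∃ c : ℝ, T a D = c • D := by
  classical
  obtain ⟨b, hbt, hDb, htb, hb⟩ := exists_linearIndepOn_id_extension (K := ℝ)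
    (s := {D}) (t := range fun a => T a D) (LinearIndepOn.singleton (v := id) hD)
    (by rintro _ rfl; exact ⟨1, by simp⟩)
  have hli : LinearIndependent ℝ (Subtype.val : b → X → ℝ) := hb
  let E := Submodule.span ℝ (range (Subtype.val : b → X → ℝ))
  have hDE : ∀ a, T a D ∈ E := fun a => by
    have := htb (mem_range_self a)
    simpa [E] using this
  have hEV : E ≤ V := by
    refine Submodule.span_le.2 ?_
    rintro _ ⟨⟨e, he⟩, rfl⟩
    obtain ⟨a, rfl⟩ := hbt he
    exact hstab a D hDV
  have hbas : ∀ e ∈ b, ∃ a, T a D = e := fun e he => hbt he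
  have hEstab : ∀ a, ∀ e ∈ E, T a e ∈ E := by
    intro a e he
    have : E ≤ E.comap (T a) := by
      refine Submodule.span_le.2 ?_
      rintro _ ⟨⟨e, he⟩, rfl⟩
      obtain ⟨c, rfl⟩ := hbas e he
      change T a (T c D) ∈ E
      rw [← Module.End.mul_apply, ← map_mul]
      exact hDE _
    exact this he
  have : FiniteDimensional ℝ V := Module.Finite.iff_fg.2 hV
  have : FiniteDimensional ℝ E := Submodule.finiteDimensional_of_le hEV
  let B : Module.Basis b ℝ E := Module.Basis.span hli
  have hBv : ∀ i, (B i : X → ℝ) = i.1 := fun i =>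
    congrArg Subtype.val (Module.Basis.span_apply hli i)
  let _ : Fintype b := FiniteDimensional.fintypeBasisIndex B
  let R : A →* Module.End ℝ E :=
    { toFun := fun a => (T a).restrict (hEstab a)
      map_one' := by ext1 e; apply Subtype.ext; simp
      map_mul' := fun x y => by ext1 e; apply Subtype.ext; simp }
  have hR : ∀ a e, (R a e : X → ℝ) = T a e := fun a e => rfl
  let P : A →* Matrix b b ℝ := (LinearMap.toMatrixAlgEquiv B).toAlgHom.toRingHom.toMonoidHom.comp R
  have hPa : ∀ a i j, P a i j = B.coord i (R a (B j)) := fun a i j =>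
    LinearMap.toMatrixAlgEquiv_apply _ _ _ _
  have hdiag : ∀ n ∈ N, ∀ i j, i ≠ j → P n i j = 0 := by
    intro n hn i j hij
    obtain ⟨a, ha⟩ := hbas j.1 j.2
    obtain ⟨c, hc⟩ := hN (a⁻¹ * n * a) (by
      simpa using (inferInstance : N.Normal).conj_mem n hn a⁻¹)
    have h1 : R n (B j) = c • B j := by
      apply Subtype.ext
      rw [hR, Submodule.coe_smul, hBv, ← ha, ← map_smul, ← hc, ← Module.End.mul_apply,
        ← Module.End.mul_apply, ← map_mul, ← map_mul]
      congr 2; group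
    rw [hPa, h1]
    simp [hij.symm]
  obtain ⟨r, ρ, h1, h2, h3⟩ := exists_representation_of_diagonal 𝒜 N hinv P
    (fun i j => by
      simp only [hPa]
      exact dual_orbit_mem 𝒜 (fun a => R a) (fun e x => h𝒜 e (hEV e.2) x) _ _) hdiag
  refine ⟨r, ρ, h1, h2, fun a ha => ?_⟩
  let i0 : b := ⟨D, hDb rfl⟩
  refine ⟨P a i0 i0, ?_⟩
  have hsum := B.sum_repr (R a (B i0))
  rw [Finset.sum_eq_single i0] at hsum
  · have := congrArg Subtype.val hsum
    rw [hR, hBv] at this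
    rw [← this, hPa, Submodule.coe_smul, hBv]
    rfl
  · intro i _ hi
    have := h3 a ha i i0 hi
    rw [hPa] at this
    rw [Module.Basis.coord_apply] at this
    rw [this, zero_smul]
  · simp

end Eigenline

section Polynomial

variable {A : Type*} [Group A]

/-- Right translation of functions on `κ → A` by the diagonal, as a representation by algebra
endomorphisms. -/
def rightTranslate (κ : Type*) (a : A) : ((κ → A) → ℝ) →ₐ[ℝ] ((κ → A) → ℝ) where
  toFun e x := e fun j => x j * a
  map_one' := rfl
  map_mul' _ _ := rfl
  map_zero' := rfl
  map_add' _ _ := rfl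
  commutes' _ := rfl

@[simp] lemma rightTranslate_apply {κ : Type*} (a : A) (e : (κ → A) → ℝ) (x : κ → A) :
    rightTranslate κ a e x = e fun j => x j * a := rfl

/-- The representation on functions by right translation. -/
def rightTranslateHom (κ : Type*) : A →* Module.End ℝ ((κ → A) → ℝ) where
  toFun a := (rightTranslate κ a).toLinearMap
  map_one' := by ext1 e; ext x; simp
  map_mul' a b := by ext1 e; ext x; simp [mul_assoc]

@[simp] lemma rightTranslateHom_apply {κ : Type*} (a : A) (e : (κ → A) → ℝ) (x : κ → A) :
    rightTranslateHom κ a e x = e fun j => x j * a := rfl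

variable {m : ℕ} (f : A →* Matrix (Fin m) (Fin m) ℝ)

/-- The space spanned by the constants and the matrix coefficients of `f` in the
various coordinates. -/
def coeffSpan (κ : Type*) : Submodule ℝ ((κ → A) → ℝ) :=
  Submodule.span ℝ (insert 1 (range fun p : κ × Fin m × Fin m => fun x => f (x p.1) p.2.1 p.2.2))

lemma one_mem_coeffSpan (κ : Type*) : 1 ∈ coeffSpan f κ :=
  Submodule.subset_span (mem_insert _ _)

lemma coeff_mem_coeffSpan {κ : Type*} (l : κ) (i j : Fin m) :
    (fun x => f (x l) i j) ∈ coeffSpan f κ :=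
  Submodule.subset_span (mem_insert_of_mem _ ⟨(l, i, j), rfl⟩)

lemma coeffSpan_fg (κ : Type*) [Finite κ] : (coeffSpan f κ).FG :=
  Submodule.fg_span ((finite_range _).insert _)

lemma coeffSpan_pow_mono (κ : Type*) {d d' : ℕ} (h : d ≤ d') :
    coeffSpan f κ ^ d ≤ coeffSpan f κ ^ d' :=
  pow_le_pow_right' (Submodule.one_le.2 (one_mem_coeffSpan f κ)) h

lemma map_coeffSpan_le (κ : Type*) (a : A) :
    (coeffSpan f κ).map (rightTranslate κ a).toLinearMap ≤ coeffSpan f κ := by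
  rw [coeffSpan, Submodule.map_span_le]
  rintro _ (rfl | ⟨⟨l, i, j⟩, rfl⟩)
  · exact one_mem_coeffSpan f κ
  · have : (rightTranslate κ a).toLinearMap (fun x => f (x l) i j) =
        ∑ t, f a t j • fun x : κ → A => f (x l) i t := by
      ext x
      simp [Matrix.mul_apply, mul_comm]
    change (rightTranslate κ a).toLinearMap (fun x => f (x l) i j) ∈ _
    rw [this]
    exact sum_mem fun t _ => Submodule.smul_mem _ _ (coeff_mem_coeffSpan f l i t)

lemma rightTranslate_mem_coeffSpan_pow {κ : Type*} (a : A) {d : ℕ} {e : (κ → A) → ℝ}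
    (he : e ∈ coeffSpan f κ ^ d) : rightTranslate κ a e ∈ coeffSpan f κ ^ d := by
  have h : (coeffSpan f κ ^ d).map (rightTranslate κ a).toLinearMap ≤ coeffSpan f κ ^ d := by
    rw [Submodule.map_pow]
    exact pow_le_pow_left' (map_coeffSpan_le f κ a) d
  exact h ⟨e, he, rfl⟩

variable (𝒜 : Subalgebra ℝ (A → ℝ))

/-- Orbit maps of polynomial functions. -/
lemma orbit_mem_of_mem_coeffSpan_pow (hf : ∀ i j, (fun a => f a i j) ∈ 𝒜) {κ : Type*} {d : ℕ}
    {e : (κ → A) → ℝ} (he : e ∈ coeffSpan f κ ^ d) (x : κ → A) :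
    (fun a => e fun j => x j * a) ∈ 𝒜 := by
  let Φ : ((κ → A) → ℝ) →ₐ[ℝ] (A → ℝ) :=
    { toFun := fun e a => e fun j => x j * a
      map_one' := rfl
      map_mul' := fun _ _ => rfl
      map_zero' := rfl
      map_add' := fun _ _ => rfl
      commutes' := fun _ => rfl }
  have h1 : coeffSpan f κ ≤ Subalgebra.toSubmodule (𝒜.comap Φ) := by
    refine Submodule.span_le.2 ?_
    rintro _ (rfl | ⟨⟨l, i, j⟩, rfl⟩)
    · exact (𝒜.comap Φ).one_mem
    · change (fun a => f (x l * a) i j) ∈ 𝒜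
      have : (fun a => f (x l * a) i j) = ∑ t, f (x l) i t • fun a => f a t j := by
        ext a
        simp [Matrix.mul_apply]
      rw [this]
      exact sum_mem fun t _ => 𝒜.smul_mem (hf t j) _
  have h2 : coeffSpan f κ ^ d ≤ Subalgebra.toSubmodule (𝒜.comap Φ) := by
    clear he
    induction d with
    | zero => exact Submodule.one_le.2 (𝒜.comap Φ).one_mem
    | succ d ih =>
      rw [pow_succ, Submodule.mul_le]
      exact fun u hu v hv => (𝒜.comap Φ).mul_mem (ih hu) (h1 hv)
  exact h2 he

/-- Polynomials in the entries of `f` lie in some power of the coefficient span. -/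
lemma exists_eval_mem_coeffSpan_pow {κ : Type*} (l : κ) (p : MvPolynomial (Fin m × Fin m) ℝ) :
    ∃ d, (fun x : κ → A => MvPolynomial.eval (fun t => f (x l) t.1 t.2) p) ∈ coeffSpan f κ ^ d := by
  induction p using MvPolynomial.induction_on with
  | C c =>
    refine ⟨0, ?_⟩
    simp only [MvPolynomial.eval_C, pow_zero]
    exact Submodule.mem_one.2 ⟨c, rfl⟩
  | add p q hp hq =>
    obtain ⟨d, hd⟩ := hp
    obtain ⟨d', hd'⟩ := hq
    refine ⟨max d d', ?_⟩
    simp only [map_add]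
    exact add_mem (coeffSpan_pow_mono f κ (le_max_left _ _) hd)
      (coeffSpan_pow_mono f κ (le_max_right _ _) hd')
  | mul_X p t hp =>
    obtain ⟨d, hd⟩ := hp
    refine ⟨d + 1, ?_⟩
    simp only [map_mul, MvPolynomial.eval_X, pow_succ]
    exact Submodule.mul_mem_mul hd (coeff_mem_coeffSpan f l t.1 t.2)

end Polynomial

lemma exists_det_ne_zero {A κ : Type*} [Fintype κ] [DecidableEq κ] (u : A → κ → ℝ)
    (hu : Submodule.span ℝ (range u) = ⊤) {a : A} (ha : u a ≠ 0) :
    ∃ x : κ → A, (∃ j, x j = a) ∧ (Matrix.of fun i j => u (x j) i).det ≠ 0 := by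
  classical
  obtain ⟨b, hbt, hab, htb, hb⟩ := exists_linearIndepOn_id_extension (K := ℝ)
    (s := {u a}) (t := range u) (LinearIndepOn.singleton (v := id) ha)
    (by rintro _ rfl; exact mem_range_self a)
  have hli : LinearIndependent ℝ (Subtype.val : b → κ → ℝ) := hb
  let B : Module.Basis b ℝ (κ → ℝ) := Module.Basis.mk hli (by
    rw [← hu, Submodule.span_le]
    simpa using htb)
  let e : κ ≃ b := (Pi.basisFun ℝ κ).indexEquiv B
  choose g hg using fun j => hbt (e j).2
  let x : κ → A := fun j => if (e j).1 = u a then a else g j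
  have hx : ∀ j, u (x j) = (e j).1 := fun j => by
    by_cases h : (e j).1 = u a
    · simp [x, h]
    · simp [x, h, hg]
  refine ⟨x, ⟨e.symm ⟨u a, hab rfl⟩, by simp [x]⟩, ?_⟩
  rw [← isUnit_iff_ne_zero, ← Matrix.isUnit_iff_isUnit_det, ← Matrix.linearIndependent_cols_iff_isUnit]
  have : (Matrix.of fun i j => u (x j) i).col = fun j => (e j).1 := by
    ext j i
    simp [hx]
  rw [this]
  exact hli.comp e e.injective

section Chevalley

variable {A : Type*} [Group A] {m : ℕ} (f : A →* Matrix (Fin m) (Fin m) ℝ)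

lemma coord_mem_coeffSpan_pow {κ : Type*} (l : κ) {d : ℕ} {e : (Unit → A) → ℝ}
    (he : e ∈ coeffSpan f Unit ^ d) : (fun x : κ → A => e fun _ => x l) ∈ coeffSpan f κ ^ d := by
  let Φ : ((Unit → A) → ℝ) →ₐ[ℝ] ((κ → A) → ℝ) :=
    { toFun := fun e x => e fun _ => x l
      map_one' := rfl
      map_mul' := fun _ _ => rfl
      map_zero' := rfl
      map_add' := fun _ _ => rfl
      commutes' := fun _ => rfl }
  have h1 : (coeffSpan f Unit).map Φ.toLinearMap ≤ coeffSpan f κ := by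
    rw [coeffSpan, Submodule.map_span_le]
    rintro _ (rfl | ⟨⟨_, i, j⟩, rfl⟩)
    · exact one_mem_coeffSpan f κ
    · exact coeff_mem_coeffSpan f l i j
  have h : (coeffSpan f Unit ^ d).map Φ.toLinearMap ≤ coeffSpan f κ ^ d := by
    rw [Submodule.map_pow]
    exact pow_le_pow_left' h1 d
  exact h ⟨e, he, rfl⟩

lemma det_mem_coeffSpan_pow {κ : Type*} [Fintype κ] [DecidableEq κ] {d : ℕ}
    {w : κ → (Unit → A) → ℝ} (hw : ∀ i, w i ∈ coeffSpan f Unit ^ d) :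
    (fun x : κ → A => (Matrix.of fun i j => w i fun _ => x j).det) ∈
      coeffSpan f κ ^ (d * Fintype.card κ) := by
  have h : (fun x : κ → A => (Matrix.of fun i j => w i fun _ => x j).det) =
      ∑ σ : Equiv.Perm κ, ((Equiv.Perm.sign σ : ℤ) : ℝ) •
        ∏ i, fun x : κ → A => w (σ i) fun _ => x i := by
    ext x
    simp [Matrix.det_apply, Units.smul_def]
  rw [h]
  refine sum_mem fun σ _ => Submodule.smul_mem _ _ ?_
  have : ∀ s : Finset κ, (∏ i ∈ s, fun x : κ → A => w (σ i) fun _ => x i) ∈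
      coeffSpan f κ ^ (d * s.card) := by
    classical
    intro s
    induction s using Finset.induction_on with
    | empty => simp
    | insert i s hi ih =>
      rw [Finset.prod_insert hi, Finset.card_insert_of_notMem hi, mul_add, mul_one, add_comm, pow_add]
      exact Submodule.mul_mem_mul (coord_mem_coeffSpan_pow f i (hw _)) ih
  exact this Finset.univ

/-- Chevalley: a normal subgroup `N` of a linear group is, up to Zariski closure, the kernel of a
linear representation. -/
theorem exists_representation_kernel_le_closure (𝒜 : Subalgebra ℝ (A → ℝ)) (N : Subgroup A)
    [N.Normal] (hinv : ∀ h ∈ 𝒜, (fun a => h a⁻¹) ∈ 𝒜) (hf : ∀ i j, (fun a => f a i j) ∈ 𝒜) :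
    ∃ (r : ℕ) (ρ : A →* Matrix (Fin r) (Fin r) ℝ), (∀ i j, (fun a => ρ a i j) ∈ 𝒜) ∧
      (∀ n ∈ N, ρ n = 1) ∧ ∀ a, ρ a = 1 → ∀ p : MvPolynomial (Fin m × Fin m) ℝ,
        (∀ n ∈ N, MvPolynomial.eval (fun t => f n t.1 t.2) p = 0) →
          MvPolynomial.eval (fun t => f a t.1 t.2) p = 0 := by
  classical
  let I : Ideal (MvPolynomial (Fin m × Fin m) ℝ) :=
    ⨅ n : N, RingHom.ker (MvPolynomial.eval fun t => f n t.1 t.2)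
  have hI : ∀ p, p ∈ I ↔ ∀ n ∈ N, MvPolynomial.eval (fun t => f n t.1 t.2) p = 0 := by
    intro p
    simp [I, RingHom.mem_ker]
  obtain ⟨s, hs⟩ := IsNoetherian.noetherian I
  choose deg hdeg using fun p => exists_eval_mem_coeffSpan_pow f (κ := Unit) () p
  let d := s.sup deg
  have hd : ∀ p ∈ s, (fun x : Unit → A => MvPolynomial.eval (fun t => f (x ()) t.1 t.2) p) ∈
      coeffSpan f Unit ^ d := fun p hp =>
    coeffSpan_pow_mono f Unit (Finset.le_sup (f := deg) hp) (hdeg p)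
  let W : Submodule ℝ ((Unit → A) → ℝ) :=
    { carrier := {v | v ∈ coeffSpan f Unit ^ d ∧ ∀ n ∈ N, v (fun _ => n) = 0}
      add_mem' := fun hv hw => ⟨add_mem hv.1 hw.1, fun n hn => by simp [hv.2 n hn, hw.2 n hn]⟩
      zero_mem' := ⟨zero_mem _, fun n hn => rfl⟩
      smul_mem' := fun c v hv => ⟨Submodule.smul_mem _ _ hv.1, fun n hn => by simp [hv.2 n hn]⟩ }
  have : FiniteDimensional ℝ (coeffSpan f Unit ^ d : Submodule ℝ ((Unit → A) → ℝ)) :=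
    Module.Finite.iff_fg.2 ((coeffSpan_fg f Unit).pow d)
  have : FiniteDimensional ℝ W := Submodule.finiteDimensional_of_le (fun v hv => hv.1 :
    W ≤ coeffSpan f Unit ^ d)
  let b := Module.finBasis ℝ W
  let k := Module.finrank ℝ W
  let u : A → Fin k → ℝ := fun a i => (b i : (Unit → A) → ℝ) fun _ => a
  have hu1 : ∀ n ∈ N, u n = 0 := fun n hn => funext fun i => (b i).2.2 n hn
  have hspan : Submodule.span ℝ (range u) = ⊤ := by
    by_contra hne
    obtain ⟨φ, hφ, hle⟩ := Submodule.exists_le_ker_of_lt_top _ (lt_top_iff_ne_top.2 hne)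
    have hc : ∑ i, φ (Pi.single i 1) • b i = 0 := by
      apply Subtype.ext
      ext x
      have h := hle (Submodule.subset_span (mem_range_self (x ())))
      have hsum : u (x ()) = ∑ i, u (x ()) i • Pi.single i (1 : ℝ) := by
        ext i
        simp [Finset.sum_apply, Pi.single_apply]
      rw [LinearMap.mem_ker, hsum, map_sum] at h
      simp only [map_smul, smul_eq_mul] at h
      simp only [Submodule.coe_sum, Submodule.coe_smul, Finset.sum_apply, Pi.smul_apply, smul_eq_mul]
      rw [Submodule.coe_zero, Pi.zero_apply, ← h]
      exact Finset.sum_congr rfl fun i _ => mul_comm _ _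
    have hc' := Fintype.linearIndependent_iff.1 b.linearIndependent _ hc
    exact hφ (LinearMap.pi_ext' fun i => LinearMap.ext_ring (hc' i))
  let D : (Fin k → A) → ℝ := fun x => (Matrix.of fun i j => u (x j) i).det
  have hDV : D ∈ coeffSpan f (Fin k) ^ (d * Fintype.card (Fin k)) :=
    det_mem_coeffSpan_pow f fun i => (b i).2.1
  have hD : D ≠ 0 := by
    by_cases h : ∃ a, u a ≠ 0
    · obtain ⟨a, ha⟩ := h
      obtain ⟨x, -, hx⟩ := exists_det_ne_zero u hspan ha
      exact fun h0 => hx (congrFun h0 x)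
    · push Not at h
      have hsub : Subsingleton (Fin k → ℝ) := by
        rw [← Submodule.subsingleton_iff ℝ, ← subsingleton_iff_bot_eq_top, ← hspan, eq_comm,
          Submodule.span_eq_bot]
        rintro _ ⟨a, rfl⟩
        exact h a
      have : IsEmpty (Fin k) := by
        by_contra hne
        rw [not_isEmpty_iff] at hne
        exact not_subsingleton (Fin k → ℝ) hsub
      intro h0
      have := congrFun h0 fun _ => 1
      simp [D, Matrix.det_isEmpty] at this
  have hN : ∀ n ∈ N, ∃ c : ℝ, rightTranslateHom (Fin k) n D = c • D := by
    intro n hn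
    have hW : ∀ v ∈ W, rightTranslate Unit n v ∈ W := fun v hv =>
      ⟨rightTranslate_mem_coeffSpan_pow f n hv.1, fun l hl => hv.2 _ (mul_mem hl hn)⟩
    let C : Matrix (Fin k) (Fin k) ℝ := Matrix.of fun i l => b.repr ⟨_, hW _ (b i).2⟩ l
    refine ⟨C.det, ?_⟩
    ext x
    change (Matrix.of fun i j => u (x j * n) i).det = C.det * (Matrix.of fun i j => u (x j) i).det
    rw [← Matrix.det_mul]
    refine congrArg _ (Matrix.ext fun i j => ?_)
    have h := b.sum_repr ⟨_, hW _ (b i).2⟩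
    have h' := congrFun (congrArg Subtype.val h) fun _ => x j
    rw [Matrix.mul_apply]
    simp only [Submodule.coe_sum, Submodule.coe_smul, Finset.sum_apply, Pi.smul_apply, smul_eq_mul,
      rightTranslate_apply] at h'
    exact h'.symm
  obtain ⟨r, ρ, h1, h2, h3⟩ := exists_representation_of_eigenvector 𝒜 N hinv
    (rightTranslateHom (Fin k)) (((coeffSpan_fg f (Fin k))).pow _)
    (fun a e he => rightTranslate_mem_coeffSpan_pow f a he)
    (fun e he x => orbit_mem_of_mem_coeffSpan_pow f 𝒜 hf he x) hDV hD hN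
  refine ⟨r, ρ, h1, h2, fun a ha p hp => ?_⟩
  obtain ⟨c, hc⟩ := h3 a ha
  have hua : u a = 0 := by
    by_contra hne
    obtain ⟨x, ⟨j, hj⟩, hx⟩ := exists_det_ne_zero u hspan hne
    have h := congrFun hc fun j => x j * a⁻¹
    have h0 : D (fun j => x j * a⁻¹) = 0 :=
      Matrix.det_eq_zero_of_column_eq_zero j fun i => by simp [hj, hu1 1 (one_mem N)]
    rw [rightTranslateHom_apply, Pi.smul_apply, h0, smul_zero] at h
    simp only [inv_mul_cancel_right] at h
    exact hx h
  have hWa : ∀ v ∈ W, v (fun _ => a) = 0 := by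
    intro v hv
    have h := congrFun (congrArg Subtype.val (b.sum_repr ⟨v, hv⟩)) fun _ => a
    simp only [Submodule.coe_sum, Submodule.coe_smul, Finset.sum_apply, Pi.smul_apply,
      smul_eq_mul] at h
    rw [← h]
    exact Finset.sum_eq_zero fun i _ => mul_eq_zero_of_right _ (congrFun hua i)
  have hle : I ≤ RingHom.ker (MvPolynomial.eval fun t => f a t.1 t.2) := by
    rw [← hs, Ideal.span_le]
    intro q hq
    have hqI : q ∈ I := hs ▸ Ideal.subset_span hq
    exact hWa _ ⟨hd q hq, (hI q).1 hqI⟩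
  exact hle ((hI p).2 hp)

end Chevalley

/-- A nonempty semialgebraic set contains an open piece of its Zariski closure. -/
lemma SA.exists_open_zariskiClosure {κ : Type*} [Finite κ] {B : Set (κ → ℝ)}
    (hB : SA fun x => x ∈ B) (hne : B.Nonempty) :
    ∃ b ∈ B, ∃ U, IsOpen U ∧ b ∈ U ∧ ∀ y ∈ U,
      (∀ p : MvPolynomial κ ℝ, (∀ z ∈ B, MvPolynomial.eval z p = 0) → MvPolynomial.eval y p = 0) →
        y ∈ B := by
  classical
  obtain ⟨T, hT⟩ := hB
  let sg : (κ → ℝ) → T → SignType := fun z p => SignType.sign (MvPolynomial.eval z p.1)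
  let Φ : Finset (T → SignType) → Prop := fun I =>
    ∀ p : MvPolynomial κ ℝ, (∀ z ∈ B, sg z ∈ I → MvPolynomial.eval z p = 0) →
      ∀ z ∈ B, MvPolynomial.eval z p = 0
  obtain ⟨I, hI, hmin⟩ := (wellFounded_lt (α := Finset (T → SignType))).has_min {I | Φ I}
    ⟨Finset.univ, fun p hp z hz => hp z hz (Finset.mem_univ _)⟩
  have hIne : I.Nonempty := by
    by_contra h
    rw [Finset.not_nonempty_iff_eq_empty] at h
    obtain ⟨z, hz⟩ := hne
    have := hI 1 (fun w _ hw => by simp [h] at hw) z hz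
    simp at this
  obtain ⟨σ, hσ⟩ := hIne
  have hnot : ¬ Φ (I.erase σ) := fun h => hmin _ h (Finset.erase_ssubset hσ)
  simp only [Φ, not_forall] at hnot
  obtain ⟨q, hq, b', hb', hqb'⟩ := hnot
  have hb : ∃ b ∈ B, sg b = σ ∧ MvPolynomial.eval b q ≠ 0 := by
    by_contra hcon
    push Not at hcon
    refine hqb' (hI q (fun z hz hzI => ?_) b' hb')
    by_cases hzσ : sg z = σ
    · exact hcon z hz hzσ
    · exact hq z hz (Finset.mem_erase.2 ⟨hzσ, hzI⟩)
  obtain ⟨b, hbB, hbσ, hqb⟩ := hb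
  let U : Set (κ → ℝ) := {y | MvPolynomial.eval y q ≠ 0} ∩
    ⋂ p : T, {y | MvPolynomial.eval b p.1 * MvPolynomial.eval y p.1 > 0 ∨ MvPolynomial.eval b p.1 = 0}
  refine ⟨b, hbB, U, ?_, ⟨hqb, ?_⟩, fun y hy hyB => ?_⟩
  · refine IsOpen.inter ?_ (isOpen_iInter_of_finite fun p => ?_)
    · exact isOpen_ne_fun (MvPolynomial.continuous_eval q) continuous_const
    · by_cases h : MvPolynomial.eval b p.1 = 0
      · simp [h]
      · simp only [h, or_false]
        exact isOpen_lt continuous_const (continuous_const.mul (MvPolynomial.continuous_eval p.1))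
  · refine mem_iInter.2 fun p => ?_
    by_cases h : MvPolynomial.eval b p.1 = 0
    · exact Or.inr h
    · exact Or.inl (mul_self_pos.2 h)
  · have hsign : sg y = sg b := by
      ext1 p
      have hp := mem_iInter.1 hy.2 p
      by_cases h : MvPolynomial.eval b p.1 = 0
      · have : MvPolynomial.eval y (p.1 * q) = 0 := by
          refine hyB _ (hI _ fun z hz hzI => ?_)
          rw [map_mul]
          by_cases hzσ : sg z = σ
          · have := congrFun (hzσ.trans hbσ.symm) p
            simp only [sg, h, sign_zero, sign_eq_zero_iff] at this
            rw [this, zero_mul]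
          · rw [hq z hz (Finset.mem_erase.2 ⟨hzσ, hzI⟩), mul_zero]
        rw [map_mul] at this
        have := (mul_eq_zero.1 this).resolve_right hy.1
        simp [sg, this, h]
      · have hpos := hp.resolve_right h
        rcases pos_and_pos_or_neg_and_neg_of_mul_pos hpos with h | h
        · simp [sg, sign_pos h.1, sign_pos h.2]
        · simp [sg, sign_neg h.1, sign_neg h.2]
    exact (hT y b fun t ht => congrFun hsign ⟨t, ht⟩).2 hbB

/-- In a linear group, a subgroup with semialgebraic image has countable index, modulo the
kernel, in any subgroup contained in its Zariski closure. -/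
lemma exists_countable_cosets {A : Type*} [Group A] {m : ℕ} (f : A →* Matrix (Fin m) (Fin m) ℝ)
    {N M : Subgroup A} (hNM : N ≤ M)
    (hN : SA fun y : Fin m × Fin m → ℝ => y ∈ (fun a t => f a t.1 t.2) '' (N : Set A))
    (hM : ∀ a ∈ M, ∀ p : MvPolynomial (Fin m × Fin m) ℝ,
      (∀ n ∈ N, MvPolynomial.eval (fun t => f n t.1 t.2) p = 0) →
        MvPolynomial.eval (fun t => f a t.1 t.2) p = 0) :
    ∃ C : Set A, C.Countable ∧ ∀ a ∈ M, ∃ c ∈ C, ∃ n ∈ N, f a = f c * f n := by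
  obtain ⟨_, ⟨b, hb, rfl⟩, U, hU, hbU, hUB⟩ := hN.exists_open_zariskiClosure ⟨_, 1, one_mem N, rfl⟩
  let V : M → Set (Fin m × Fin m → ℝ) := fun a =>
    (fun y t => ∑ s, f (b * a.1⁻¹) t.1 s * y (s, t.2)) ⁻¹' U
  have hV : ∀ a, IsOpen (V a) := fun a => hU.preimage (by fun_prop)
  have hmem : ∀ a : M, ∀ a', (fun t => f a' t.1 t.2) ∈ V a ↔
      (fun t : Fin m × Fin m => f (b * a.1⁻¹ * a') t.1 t.2) ∈ U := by
    intro a a'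
    have : (fun t : Fin m × Fin m => f (b * a.1⁻¹ * a') t.1 t.2) =
        fun t => ∑ s, f (b * a.1⁻¹) t.1 s * f a' s t.2 := by
      ext t
      rw [map_mul f (b * a.1⁻¹), Matrix.mul_apply]
    rw [this]
    rfl
  obtain ⟨T, hT, hTU⟩ := TopologicalSpace.isOpen_iUnion_countable V hV
  refine ⟨(fun a : M => a.1 * b⁻¹) '' T, hT.image _, fun a ha => ?_⟩
  have haV : (fun t : Fin m × Fin m => f a t.1 t.2) ∈ ⋃ a, V a :=
    mem_iUnion.2 ⟨⟨a, ha⟩, (hmem _ _).2 (by simpa using hbU)⟩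
  rw [← hTU] at haV
  obtain ⟨c, hc, hac⟩ := mem_iUnion₂.1 haV
  obtain ⟨n, hn, hfn⟩ := hUB _ ((hmem c a).1 hac) fun p hp =>
    hM _ (mul_mem (mul_mem (hNM hb) (inv_mem c.2)) ha) p fun n hn => hp _ ⟨n, hn, rfl⟩
  refine ⟨_, ⟨c, hc, rfl⟩, n, hn, ?_⟩
  have h : f n = f (b * c.1⁻¹ * a) := by
    ext i j
    exact congrFun hfn (i, j)
  rw [h, ← map_mul]
  congr 1
  group

section NashSubgroups

variable {G Q : NashGroup}

/-- The group structure on a Nash subgroup. -/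
@[reducible] def IsNashSubgroup.group {K : Set (Fin G.n → ℝ)} (hK : IsNashSubgroup G K) :
    Group K :=
  letI : Mul K := ⟨fun x y => ⟨G.mul x y, hK.mul_mem _ x.2 _ y.2⟩⟩
  letI : Inv K := ⟨fun x => ⟨G.inv x, hK.inv_mem _ x.2⟩⟩
  letI : One K := ⟨⟨G.one, hK.one_mem⟩⟩
  Group.ofLeftAxioms
    (fun x y z => Subtype.ext
      (G.mul_assoc _ (hK.subset x.2) _ (hK.subset y.2) _ (hK.subset z.2)))
    (fun x => Subtype.ext (G.one_mul _ (hK.subset x.2)))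
    fun x => Subtype.ext (G.inv_mul_cancel _ (hK.subset x.2))

lemma NashGroup.isNashSubgroup_carrier (G : NashGroup) : IsNashSubgroup G G.carrier where
  subset := Subset.rfl
  one_mem := G.one_mem
  mul_mem := G.mul_mem
  inv_mem := G.inv_mem
  semialg := G.semialg

/-- The group homomorphism underlying a Nash homomorphism. -/
def IsNashHomOn.toMonoidHom {π : (Fin G.n → ℝ) → (Fin Q.n → ℝ)} (hπ : IsNashHomOn G G.carrier Q π)
    {K : Set (Fin G.n → ℝ)} (hK : IsNashSubgroup G K) :
    letI := hK.group
    letI := Q.isNashSubgroup_carrier.group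
    K →* Q.carrier :=
  letI := hK.group
  letI := Q.isNashSubgroup_carrier.group
  MonoidHom.mk' (fun x => ⟨π x, hπ.mapsTo _ (hK.subset x.2)⟩) fun x y =>
    Subtype.ext (hπ.map_mul _ (hK.subset x.2) _ (hK.subset y.2))

lemma LocAnalyticOn.continuousOn {n m : ℕ} {S : Set (Fin n → ℝ)} {f : (Fin n → ℝ) → (Fin m → ℝ)}
    (hf : LocAnalyticOn S f) : ContinuousOn f S := by
  intro x hx
  obtain ⟨U, hU, hxU, g, hg, hgf⟩ := hf x hx
  refine ((hg x hxU).continuousAt.continuousWithinAt (s := S)).congr_of_eventuallyEq ?_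
    (hgf x ⟨hxU, hx⟩).symm
  filter_upwards [mem_nhdsWithin_of_mem_nhds (hU.mem_nhds hxU), self_mem_nhdsWithin] with y hy hyS
  exact (hgf y ⟨hy, hyS⟩).symm

/-- A map that factors through a semialgebraic map is semialgebraic. -/
lemma SAGraph.descend {ι κ μ : Type} [Finite ι] {S : Set (ι → ℝ)}
    {F : (ι → ℝ) → κ → ℝ} {Φ : (ι → ℝ) → μ → ℝ} {Ψ : (κ → ℝ) → μ → ℝ} (hF : SAGraph S F)
    (hΦ : SAGraph S Φ) (h : ∀ x ∈ S, Ψ (F x) = Φ x) : SAGraph (F '' S) Ψ := by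
  refine (SA.exists_vec (ι := κ ⊕ μ) (κ := ι)
    (P := fun z x => (x ∈ S ∧ F x = fun k => z (Sum.inl k)) ∧ (x ∈ S ∧ Φ x = fun k => z (Sum.inr k)))
    ((hF.comp (Sum.elim Sum.inr fun k => Sum.inl (Sum.inl k))).and
      (hΦ.comp (Sum.elim Sum.inr fun k => Sum.inl (Sum.inr k))))).congr fun z => ?_
  constructor
  · rintro ⟨x, ⟨hx, h1⟩, -, h2⟩
    rw [← h1, ← h2]
    exact ⟨mem_image_of_mem F hx, h x hx⟩
  · rintro ⟨⟨x, hx, h1⟩, h2⟩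
    refine ⟨x, ⟨hx, h1⟩, hx, ?_⟩
    rw [← h2, ← h1, h x hx]

/-- Reshaping followed by left multiplication by `M`. -/
def flatMulLeft {r : ℕ} (M : Matrix (Fin r) (Fin r) ℝ) :
    (Fin (r * r) → ℝ) →ₗ[ℝ] (Fin (r * r) → ℝ) where
  toFun v := matFlatten (M * Matrix.of fun i j => v (finProdFinEquiv (i, j)))
  map_add' v w := by
    ext k; simp [matFlatten, Matrix.mul_apply, mul_add, Finset.sum_add_distrib]
  map_smul' c v := by
    ext k; simp [matFlatten, Matrix.mul_apply, Finset.mul_sum, mul_left_comm]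

lemma flatMulLeft_matFlatten {r : ℕ} (M R : Matrix (Fin r) (Fin r) ℝ) :
    flatMulLeft M (matFlatten R) = matFlatten (M * R) := by
  change matFlatten (M * _) = _
  congr 2
  ext i j
  simp [matFlatten]

/-- Semialgebraic homomorphisms to a matrix group are analytic. -/
lemma IsNashSubgroup.locAnalyticOn_of_map_mul {K : Set (Fin Q.n → ℝ)} (hK : IsNashSubgroup Q K)
    {r : ℕ} {R : (Fin Q.n → ℝ) → Matrix (Fin r) (Fin r) ℝ}
    (hR : ∀ x ∈ K, ∀ y ∈ K, R (Q.mul x y) = R x * R y)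
    (hsa : SAGraph K fun x => matFlatten (R x)) : LocAnalyticOn K fun x => matFlatten (R x) := by
  let _ := hK.group
  intro x₁ hx₁
  obtain ⟨U, hU, ⟨x₀, hx₀U, hx₀⟩, h, hh, hhR⟩ := hsa.exists_analytic Subset.rfl ⟨_, hx₁⟩
  let c : K := ⟨x₀, hx₀⟩ * ⟨x₁, hx₁⟩⁻¹
  have hcx : Q.mul c x₁ = x₀ := by
    have : c * ⟨x₁, hx₁⟩ = ⟨x₀, hx₀⟩ := by simp [c]
    exact congrArg Subtype.val this
  have hcy : ∀ y ∈ K, R y = R (c⁻¹ : K) * R (Q.mul c y) := by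
    intro y hy
    rw [← hR _ (c⁻¹).2 _ (hK.mul_mem _ c.2 _ hy)]
    have : c⁻¹ * (c * ⟨y, hy⟩) = ⟨y, hy⟩ := by simp
    exact congrArg R (congrArg Subtype.val this).symm
  let α : (Fin Q.n → ℝ) → Fin (Q.n + Q.n) → ℝ := fun y => Fin.append c.1 y
  have hα : AnalyticOnNhd ℝ α univ := by
    refine AnalyticOnNhd.pi fun i => ?_
    refine Fin.addCases (fun i => ?_) (fun i => ?_) i
    · simpa [α] using analyticOnNhd_const
    · simp only [Fin.append_right]
      exact (ContinuousLinearMap.proj (R := ℝ)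
        (φ := fun _ : Fin Q.n => ℝ) i).analyticOnNhd univ
  have hfront : ∀ y, frontHalf (α y) = c.1 := fun y => by ext i; simp [frontHalf, α]
  have hback : ∀ y, backHalf (α y) = y := fun y => by
    ext i; exact Fin.append_right _ _ _
  obtain ⟨W, hW, hxW, g, hg, hgm⟩ := Q.mul_nash.1 (α x₁)
    ⟨by rw [hfront]; exact hK.subset c.2, by rw [hback]; exact hK.subset hx₁⟩
  have hgα : ∀ y, α y ∈ W → y ∈ K → g (α y) = Q.mul c y := fun y hy hyK => by
    rw [hgm _ ⟨hy, by rw [hfront]; exact hK.subset c.2, by rw [hback]; exact hK.subset hyK⟩]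
    change Q.mul (frontHalf (α y)) (backHalf (α y)) = _
    rw [hfront, hback]
  have hcomp : AnalyticOnNhd ℝ (fun y => g (α y)) (α ⁻¹' W) :=
    hg.comp (hα.mono (subset_univ _)) fun _ hy => hy
  have hαW : IsOpen (α ⁻¹' W) := hW.preimage (continuousOn_univ.1 hα.continuousOn)
  refine ⟨α ⁻¹' W ∩ (fun y => g (α y)) ⁻¹' U, hcomp.continuousOn.isOpen_inter_preimage hαW hU,
    ⟨hxW, ?_⟩, fun y => flatMulLeft (R (c⁻¹ : K)) (h (g (α y))), ?_, ?_⟩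
  · rw [mem_preimage, hgα _ hxW hx₁, hcx]
    exact hx₀U
  · exact (LinearMap.toContinuousLinearMap (flatMulLeft (R (c⁻¹ : K)))).comp_analyticOnNhd
      (hh.comp (hcomp.mono inter_subset_left) fun _ hy => hy.2)
  · rintro y ⟨⟨hyW, hyU⟩, hyK⟩
    rw [mem_preimage, hgα y hyW hyK] at hyU
    change flatMulLeft _ (h (g (α y))) = _
    rw [hgα y hyW hyK, hhR _ ⟨hyU, hK.mul_mem _ c.2 _ hyK⟩, flatMulLeft_matFlatten, ← hcy y hyK]

end NashSubgroups

lemma matFlatten_apply {r : ℕ} (M : Matrix (Fin r) (Fin r) ℝ) (i j : Fin r) :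
    matFlatten M (finProdFinEquiv (i, j)) = M i j := by
  simp [matFlatten]

lemma SA.eq_const {κ : Type*} [Finite κ] (c : κ → ℝ) : SA fun w => w = c :=
  (SA.forall_finite fun k => SA.eval_eq (MvPolynomial.X k) (MvPolynomial.C (c k))).congr fun w => by
    simp [funext_iff]

section Images

variable {G Q : NashGroup} {π : (Fin G.n → ℝ) → (Fin Q.n → ℝ)}

lemma IsNashHomOn.saGraph (hπ : IsNashHomOn G G.carrier Q π) {K : Set (Fin G.n → ℝ)}
    (hK : IsNashSubgroup G K) : SAGraph K π :=
  (isSemialgebraic_nashGraph_iff.1 hπ.nash.2).restrict (isSemialgebraic_iff_sa.1 hK.semialg)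
    hK.subset

lemma IsNashSubgroup.image {K : Set (Fin G.n → ℝ)} (hK : IsNashSubgroup G K)
    (hπ : IsNashHomOn G G.carrier Q π) : IsNashSubgroup Q (π '' K) := by
  let _ := hK.group
  let _ := Q.isNashSubgroup_carrier.group
  let φ := hπ.toMonoidHom hK
  refine ⟨?_, ⟨G.one, hK.one_mem, congrArg Subtype.val (map_one φ)⟩, ?_, ?_, ?_⟩
  · rintro _ ⟨x, hx, rfl⟩
    exact hπ.mapsTo x (hK.subset hx)
  · rintro _ ⟨x, hx, rfl⟩ _ ⟨y, hy, rfl⟩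
    exact ⟨_, hK.mul_mem x hx y hy, hπ.map_mul x (hK.subset hx) y (hK.subset hy)⟩
  · rintro _ ⟨x, hx, rfl⟩
    exact ⟨_, hK.inv_mem x hx, congrArg Subtype.val (map_inv φ (⟨x, hx⟩ : K))⟩
  · exact isSemialgebraic_iff_sa.2 (hπ.saGraph hK).image

/-- Images of almost linear Nash groups are almost linear. -/
theorem AlmostLinearOn.image {K : Set (Fin G.n → ℝ)} (hlin : AlmostLinearOn G K)
    (hK : IsNashSubgroup G K) (hπ : IsNashHomOn G G.carrier Q π) : AlmostLinearOn Q (π '' K) := by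
  classical
  obtain ⟨m, f, hfnash, hfunit, hfmul, hffin⟩ := hlin
  let _ := hK.group
  let _ := Q.isNashSubgroup_carrier.group
  let φ := hπ.toMonoidHom hK
  have hKsa := isSemialgebraic_iff_sa.1 hK.semialg
  have hfsa : SAGraph K fun x => matFlatten (f x) := isSemialgebraic_nashGraph_iff.1 hfnash.2
  have hπsa := hπ.saGraph hK
  let fh : K →* Matrix (Fin m) (Fin m) ℝ :=
    { toFun := fun x => f x
      map_one' := by
        have h := hfmul _ hK.one_mem _ hK.one_mem
        rw [G.one_mul _ G.one_mem] at h
        exact (hfunit _ hK.one_mem).mul_left_cancel (h.symm.trans (mul_one _).symm)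
      map_mul' := fun x y => hfmul _ x.2 _ y.2 }
  have hentry : ∀ i j, SAFun K fun x => f x i j := fun i j => by
    simpa [matFlatten] using hfsa.component (finProdFinEquiv (i, j))
  let 𝒜 := saAlgebra K hKsa
  have hinv : ∀ h ∈ 𝒜, (fun a => h a⁻¹) ∈ 𝒜 := by
    rintro h ⟨g, hg, hgh⟩
    have hinvsa : SAGraph K G.inv := (isSemialgebraic_nashGraph_iff.1 G.inv_nash.2).restrict
      hKsa hK.subset
    have hg' : SAGraph K fun x (_ : Unit) => g x := SAFun.pi hKsa fun _ => hg
    exact ⟨_, (hinvsa.funComp hg' fun x hx => hK.inv_mem x hx).component (), fun a => hgh a⁻¹⟩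
  obtain ⟨r, ρ, hρ𝒜, hρN, hρcl⟩ := exists_representation_kernel_le_closure fh 𝒜 φ.ker hinv
    fun i j => ⟨_, hentry i j, fun a => rfl⟩
  choose g hg hgρ using hρ𝒜
  let Φ : (Fin G.n → ℝ) → Matrix (Fin r) (Fin r) ℝ := fun x => Matrix.of fun i j => g i j x
  have hΦρ : ∀ a : K, Φ a = ρ a := fun a => by
    ext i j
    exact (hgρ i j a).symm
  have hΦsa : SAGraph K fun x => matFlatten (Φ x) := SAFun.pi hKsa fun k => hg _ _
  let R : (Fin Q.n → ℝ) → Matrix (Fin r) (Fin r) ℝ := fun y =>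
    if h : ∃ x ∈ K, π x = y then Φ h.choose else 1
  have hR : ∀ x ∈ K, R (π x) = Φ x := by
    intro x hx
    have h : ∃ x' ∈ K, π x' = π x := ⟨x, hx, rfl⟩
    have hR' : R (π x) = Φ h.choose := dif_pos h
    have h1 := h.choose_spec
    have hφ : φ ⟨h.choose, h1.1⟩ = φ ⟨x, hx⟩ := Subtype.ext h1.2
    have hker : (⟨x, hx⟩ : K)⁻¹ * ⟨h.choose, h1.1⟩ ∈ φ.ker := by
      rw [MonoidHom.mem_ker, map_mul, hφ, map_inv, inv_mul_cancel]
    rw [hR', hΦρ ⟨_, h1.1⟩, hΦρ ⟨x, hx⟩,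
      show (⟨h.choose, h1.1⟩ : K) = ⟨x, hx⟩ * (⟨x, hx⟩⁻¹ * ⟨h.choose, h1.1⟩) by simp, map_mul,
      hρN _ hker, mul_one]
  have hRmul : ∀ x ∈ π '' K, ∀ y ∈ π '' K, R (Q.mul x y) = R x * R y := by
    rintro _ ⟨x, hx, rfl⟩ _ ⟨y, hy, rfl⟩
    rw [← hπ.map_mul x (hK.subset hx) y (hK.subset hy), hR _ (hK.mul_mem x hx y hy), hR x hx,
      hR y hy, hΦρ ⟨x, hx⟩, hΦρ ⟨y, hy⟩, ← map_mul]
    exact hΦρ (⟨x, hx⟩ * ⟨y, hy⟩)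
  have hRsa : SAGraph (π '' K) fun y => matFlatten (R y) :=
    hπsa.descend hΦsa fun x hx => by rw [hR x hx]
  refine ⟨r, R, ⟨(hK.image hπ).locAnalyticOn_of_map_mul hRmul hRsa,
    isSemialgebraic_nashGraph_iff.2 hRsa⟩, ?_, hRmul, ?_⟩
  · rintro _ ⟨x, hx, rfl⟩
    rw [hR x hx, hΦρ ⟨x, hx⟩]
    exact (Group.isUnit (⟨x, hx⟩ : K)).map ρ
  · have hRfin : SA fun y => y ∈ {y ∈ π '' K | R y = 1} := by
      refine (hRsa.preimage (SA.eq_const (matFlatten (1 : Matrix (Fin r) (Fin r) ℝ)))).congr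
        fun y => and_congr_right fun _ => ⟨fun h => ?_, fun h => by rw [h]⟩
      ext i j
      simpa only [matFlatten_apply] using congrFun h (finProdFinEquiv (i, j))
    refine hRfin.finite_of_countable ?_
    have hNsa : SA fun y : Fin m × Fin m → ℝ =>
        y ∈ (fun a t => fh a t.1 t.2) '' (φ.ker : Set K) := by
      have hker : SA fun x => x ∈ {x ∈ K | π x = Q.one} :=
        hπsa.preimage (SA.eq_const Q.one)
      have hent : SAGraph K fun x (t : Fin m × Fin m) => f x t.1 t.2 :=
        SAFun.pi hKsa fun t => hentry t.1 t.2
      refine (hent.restrict hker (sep_subset _ _)).image.congr fun y => ?_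
      constructor
      · rintro ⟨x, ⟨hx, h1⟩, rfl⟩
        exact ⟨⟨x, hx⟩, Subtype.ext h1, rfl⟩
      · rintro ⟨x, hx, rfl⟩
        exact ⟨x, ⟨x.2, congrArg Subtype.val hx⟩, rfl⟩
    obtain ⟨C, hC, hcover⟩ := exists_countable_cosets fh (N := φ.ker) (M := ρ.ker)
      (fun n hn => hρN n hn) hNsa fun a ha => hρcl a ha
    have hfker : {k : K | fh k = 1}.Finite := by
      refine Finite.of_finite_image (f := Subtype.val) (hffin.subset ?_) Subtype.val_injective.injOn
      rintro _ ⟨k, hk, rfl⟩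
      exact ⟨k.2, hk⟩
    refine ((hC.prod hfker.countable).image fun p => (φ (p.1 * p.2) : Fin Q.n → ℝ)).mono ?_
    rintro _ ⟨⟨x, hx, rfl⟩, h1⟩
    rw [hR x hx, hΦρ ⟨x, hx⟩] at h1
    obtain ⟨c, hc, n, hn, hfx⟩ := hcover ⟨x, hx⟩ h1
    refine ⟨(c, (c * n)⁻¹ * ⟨x, hx⟩), ⟨hc, ?_⟩, ?_⟩
    · change fh _ = 1
      rw [map_mul, hfx, ← map_mul, ← map_mul, inv_mul_cancel, map_one]
    · have : φ (c * ((c * n)⁻¹ * ⟨x, hx⟩)) = φ ⟨x, hx⟩ := by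
        rw [map_mul, map_mul, map_inv, map_mul, MonoidHom.mem_ker.1 hn]
        group
      exact congrArg Subtype.val this

end Images

/-- For a connected affine Nash group, the connected normal almost linear Nash
subgroup with abelian Nash manifold quotient coincides with the largest
connected almost linear Nash subgroup; in particular, some quotient of `G` by
the largest connected almost linear Nash subgroup is an abelian Nash
manifold. -/
theorem chevalley_subgroup_eq_largest_almost_linear (G : NashGroup)
    (hG : IsConnected G.carrier) (H Haff : Set (Fin G.n → ℝ))
    (hsub : IsNashSubgroup G H) (hconn : IsConnected H)
    (hnorm : IsNormalIn G G.carrier H) (hlin : AlmostLinearOn G H)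
    (hquot : ∃ (Q : NashGroup) (π : (Fin G.n → ℝ) → (Fin Q.n → ℝ)),
      IsNashHomOn G G.carrier Q π ∧ π '' G.carrier = Q.carrier ∧
      {x ∈ G.carrier | π x = Q.one} = H ∧ AbelianNashManifold Q)
    (haff_sub : IsNashSubgroup G Haff) (haff_conn : IsConnected Haff)
    (haff_lin : AlmostLinearOn G Haff)
    (haff_large : ∀ K : Set (Fin G.n → ℝ), IsNashSubgroup G K → IsConnected K →
      AlmostLinearOn G K → K ⊆ Haff) :
    H = Haff ∧
    ∃ (Q : NashGroup) (π : (Fin G.n → ℝ) → (Fin Q.n → ℝ)),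
      IsNashHomOn G G.carrier Q π ∧ π '' G.carrier = Q.carrier ∧
      {x ∈ G.carrier | π x = Q.one} = Haff ∧ AbelianNashManifold Q := by
  obtain ⟨Q, π, hπ, hsurj, hker, hQ⟩ := hquot
  have hle : Haff ⊆ H := by
    have hK := hQ.2 _ (haff_sub.image hπ)
      (haff_conn.image _ (hπ.nash.1.continuousOn.mono haff_sub.subset))
      (haff_lin.image haff_sub hπ)
    intro x hx
    rw [← hker]
    exact ⟨haff_sub.subset hx, by simpa [hK] using mem_image_of_mem π hx⟩
  have heq : H = Haff := (haff_large H hsub hconn hlin).antisymm hle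
  exact ⟨heq, Q, π, hπ, hsurj, hker.trans heq, hQ⟩
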